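/- Let X be a locally geodesic metric space homeomorphic to D̄ and let ε > 0. Then there exists ε' > 0 such that for every x ∈ X there is a biLipschitz curve T ⊂ X with the following property: either T is the boundary of a Jordan domain Ω containing B̄(x,ε') with diam Ω ≤ ε; or T is a Jordan arc intersecting the boundary circle ∂X exactly at its two endpoints, and some connected component Ω of X∖T contains B̄(x,ε') and satisfies diam Ω ≤ ε. -/

import Mathlib

noncomputable section

/-- The Euclidean plane `ℝ²`. -/
abbrev E2 : Type := EuclideanSpace ℝ (Fin 2)

/-- The open unit disc `D ⊆ ℝ²`. -/
def unitDisc : Set E2 := Metric.ball 0 1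

/-- The closed unit disc `D̄ ⊆ ℝ²`. -/
def unitClosedDisc : Set E2 := Metric.closedBall 0 1

/-- The unit circle `S¹ ⊆ ℝ²`. -/
def unitCircle : Set E2 := Metric.sphere 0 1

/-- A curve in a metric space: a function which is continuous on a compact interval `[a,b]`. -/
structure MCurve (X : Type*) [PseudoEMetricSpace X] where
  a : ℝ
  b : ℝ
  hab : a ≤ b
  toFun : ℝ → X
  cont : ContinuousOn toFun (Set.Icc a b)

/-- The length of a curve, i.e. its total variation. -/
def MCurve.length {X : Type*} [PseudoEMetricSpace X] (γ : MCurve X) : ENNReal :=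
  eVariationOn γ.toFun (Set.Icc γ.a γ.b)

/-- A metric space is geodesic if any two points are joined by a curve whose length equals
their distance. -/
def IsGeodesicSpace (X : Type*) [MetricSpace X] : Prop :=
  ∀ x y : X, ∃ γ : MCurve X, γ.toFun γ.a = x ∧ γ.toFun γ.b = y ∧ γ.length = edist x y

/-- A metric space is locally geodesic if every point has a neighborhood `U` such that any two
points of `U` are joined by a geodesic in `X`. -/
def IsLocallyGeodesicSpace (X : Type*) [MetricSpace X] : Prop :=
  ∀ x : X, ∃ U ∈ nhds x, ∀ y ∈ U, ∀ z ∈ U,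
    ∃ γ : MCurve X, γ.toFun γ.a = y ∧ γ.toFun γ.b = z ∧ γ.length = edist y z

/-- The vertices of the standard equilateral Euclidean simplex of side length `r`. -/
def simplexVertex (r : ℝ) (i : Fin 3) : EuclideanSpace ℝ (Fin 3) :=
  (r / Real.sqrt 2) • EuclideanSpace.single i (1:ℝ)

/-- The standard equilateral Euclidean `k`-simplex of side length `r` (for `k ≤ 2`). -/
def euclideanSimplex (r : ℝ) (k : Fin 3) : Set (EuclideanSpace ℝ (Fin 3)) :=
  convexHull ℝ (simplexVertex r '' {i : Fin 3 | i ≤ k})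

/-- A finite metric simplicial complex of dimension at most `2`, equipped with a geodesic
metric in which every simplex is a Euclidean simplex of side length `r`. -/
structure EuclideanComplex2 (r : ℝ) where
  space : Type
  [metricSpace : MetricSpace space]
  [measurableSpace : MeasurableSpace space]
  [borelSpace : BorelSpace space]
  ι : Type
  [finite : Finite ι]
  dim : ι → Fin 3
  face : ι → Set space
  face_isom : ∀ i, Nonempty (↥(face i) ≃ᵢ ↥(euclideanSimplex r (dim i)))
  covers : ⋃ i, face i = Set.univ
  geodesic : IsGeodesicSpace space

attribute [instance] EuclideanComplex2.metricSpace EuclideanComplex2.measurableSpace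
  EuclideanComplex2.borelSpace EuclideanComplex2.finite

/-- The `1`-skeleton of such a complex. -/
def EuclideanComplex2.oneSkeleton {r : ℝ} (K : EuclideanComplex2 r) : Set K.space :=
  ⋃ i ∈ {i | K.dim i ≤ 1}, K.face i

open Metric MeasureTheory Set Filter Topology ENNReal NNReal



/-- The metric speed `|f'|(t)` of a map `f : ℝ → X`. -/
def metricSpeed {X : Type*} [PseudoEMetricSpace X] (f : ℝ → X) (t : ℝ) : ℝ≥0∞ :=
  Filter.limsup (fun s : ℝ => edist (f s) (f t) / ENNReal.ofReal |s - t|) (𝓝[≠] t)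

/-- The path integral `∫_γ ρ` of a Borel density `ρ` along a curve `γ`. -/
def MCurve.pathIntegral {X : Type*} [PseudoEMetricSpace X] (γ : MCurve X) (ρ : X → ℝ≥0∞) : ℝ≥0∞ :=
  ∫⁻ t in Set.Icc γ.a γ.b, ρ (γ.toFun t) * metricSpeed γ.toFun t

/-- The family of curves whose image is contained in `S`. -/
def CurvesIn {X : Type*} [PseudoEMetricSpace X] (S : Set X) : Set (MCurve X) :=
  {γ | ∀ t ∈ Set.Icc γ.a γ.b, γ.toFun t ∈ S}

/-- The family `u ∘ Γ` of all compositions `u ∘ γ`, `γ ∈ Γ`. -/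
def mapFamily {X Y : Type*} [PseudoEMetricSpace X] [PseudoEMetricSpace Y]
    (u : X → Y) (Γ : Set (MCurve X)) : Set (MCurve Y) :=
  {δ | ∃ γ ∈ Γ, δ.a = γ.a ∧ δ.b = γ.b ∧ δ.toFun = u ∘ γ.toFun}

section Modulus

variable {X : Type*} [EMetricSpace X] [MeasurableSpace X] [BorelSpace X]

/-- A Borel function `ρ` is admissible for the curve family `Γ` if `∫_γ ρ ≥ 1` for every
(locally) rectifiable curve in `Γ`. -/
def Admissible (Γ : Set (MCurve X)) (ρ : X → ℝ≥0∞) : Prop :=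
  Measurable ρ ∧ ∀ γ ∈ Γ, γ.length ≠ ⊤ → 1 ≤ γ.pathIntegral ρ

/-- The conformal modulus of a family of curves, with respect to Hausdorff `2`-measure. -/
def MOD (Γ : Set (MCurve X)) : ℝ≥0∞ :=
  ⨅ (ρ : X → ℝ≥0∞) (_ : Admissible Γ ρ), ∫⁻ x, ρ x ^ 2 ∂(μH[2] : Measure X)

/-- The family of curves joining `E` and `F` within `G`. -/
def joiningCurves (E F G : Set X) : Set (MCurve X) :=
  {γ | (∀ t ∈ Set.Icc γ.a γ.b, γ.toFun t ∈ G) ∧ γ.toFun γ.a ∈ E ∧ γ.toFun γ.b ∈ F}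

/-- `MOD(E, F; G)`, the modulus of the family of curves joining `E` and `F` within `G`. -/
def MODJoin (E F G : Set X) : ℝ≥0∞ := MOD (joiningCurves E F G)

end Modulus


/-- A Jordan curve: a subset homeomorphic to the unit circle. -/
def IsJordanCurve {X : Type*} [TopologicalSpace X] (Γ : Set X) : Prop :=
  Nonempty (↥Γ ≃ₜ ↥unitCircle)

/-- A Jordan domain: a domain whose boundary is a Jordan curve. -/
def IsJordanDomain {X : Type*} [TopologicalSpace X] (Ω : Set X) : Prop :=
  IsOpen Ω ∧ IsConnected Ω ∧ IsJordanCurve (frontier Ω)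

/-- A subset has finite length if it is the image of a rectifiable curve. -/
def HasFiniteLength {X : Type*} [MetricSpace X] (Γ : Set X) : Prop :=
  ∃ γ : MCurve X, γ.toFun '' Set.Icc γ.a γ.b = Γ ∧ γ.length ≠ ⊤

/-- `u` restricted to `S` is a homeomorphism onto `T`. -/
def RestrictsToHomeo {A X : Type*} [TopologicalSpace A] [TopologicalSpace X]
    (u : A → X) (S : Set A) (T : Set X) : Prop :=
  ∃ e : ↥S ≃ₜ ↥T, ∀ z : ↥S, (e z : X) = u (z : A)

/-- Condition (⋆): points have vanishing modulus. -/
def PointsZeroModulus (X : Type*) [MetricSpace X] [MeasurableSpace X] [BorelSpace X] : Prop :=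
  ∀ (x : X) (R : ℝ), 0 < R → ((Metric.ball x R)ᶜ).Nonempty →
    Filter.Tendsto
      (fun r : ℝ => MODJoin (Metric.ball x r) (Metric.ball x R)ᶜ (Metric.closedBall x R))
      (𝓝[>] (0:ℝ)) (𝓝 0)

/-- Condition (⋆⋆): for every closed topological square `Q ⊆ X` with boundary edges
`ζ₁, ζ₂, ζ₃, ζ₄` in cyclic order, `MOD(ζ₁,ζ₃;Q) ⬝ MOD(ζ₂,ζ₄;Q) ≤ κ`. -/
def SquareCondition (X : Type*) [MetricSpace X] [MeasurableSpace X] [BorelSpace X]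
    (κ : ℝ≥0∞) : Prop :=
  ∀ (φ : ℝ × ℝ → X) (Q : Set X),
    RestrictsToHomeo φ (Set.Icc (0:ℝ) 1 ×ˢ Set.Icc (0:ℝ) 1) Q →
    MODJoin (φ '' (Set.Icc (0:ℝ) 1 ×ˢ {(0:ℝ)})) (φ '' (Set.Icc (0:ℝ) 1 ×ˢ {(1:ℝ)})) Q *
      MODJoin (φ '' ({(0:ℝ)} ×ˢ Set.Icc (0:ℝ) 1)) (φ '' ({(1:ℝ)} ×ˢ Set.Icc (0:ℝ) 1)) Q ≤ κ

section Sobolev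

variable {X : Type*} [MetricSpace X]

/-- `g` is a weak upper gradient of `u` on `U`: the upper gradient inequality holds along all
rectifiable curves in `U` outside an exceptional family of modulus zero. -/
def IsWeakUpperGradientOn (u : E2 → X) (U : Set E2) (g : E2 → ℝ≥0∞) : Prop :=
  ∃ Γ₀ : Set (MCurve E2), MOD Γ₀ = 0 ∧
    ∀ γ : MCurve E2, γ ∈ CurvesIn U → γ.length ≠ ⊤ → γ ∉ Γ₀ →
      edist (u (γ.toFun γ.a)) (u (γ.toFun γ.b)) ≤ γ.pathIntegral g

/-- Membership in the Newton–Sobolev space `N^{1,2}(U, X)`. -/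
def MemN12 (U : Set E2) (u : E2 → X) : Prop :=
  AEStronglyMeasurable u (volume.restrict U) ∧
  (∃ x₀ : X, (∫⁻ z in U, edist (u z) x₀ ^ 2) ≠ ⊤) ∧
  ∃ g : E2 → ℝ≥0∞, Measurable g ∧ IsWeakUpperGradientOn u U g ∧ (∫⁻ z in U, g z ^ 2) ≠ ⊤

/-- The Reshetnyak energy `E²₊(u)` of `u` on the unit disc: the infimum of `∫_D g²` over all
weak upper gradients `g` of `u` (attained by the minimal weak upper gradient). -/
def energy (u : E2 → X) : ℝ≥0∞ :=
  ⨅ (g : E2 → ℝ≥0∞) (_ : Measurable g ∧ IsWeakUpperGradientOn u unitDisc g),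
    ∫⁻ z in unitDisc, g z ^ 2

/-- `g` is the minimal weak upper gradient of `u` on the unit disc. -/
def IsMinimalWUG (u : E2 → X) (g : E2 → ℝ≥0∞) : Prop :=
  Measurable g ∧ IsWeakUpperGradientOn u unitDisc g ∧ (∫⁻ z in unitDisc, g z ^ 2) ≠ ⊤ ∧
    ∀ h : E2 → ℝ≥0∞, Measurable h → IsWeakUpperGradientOn u unitDisc h →
      (∫⁻ z in unitDisc, h z ^ 2) ≠ ⊤ → ∀ᵐ z ∂(volume.restrict unitDisc), g z ≤ h z

/-- `c` is a representative of the trace of `u`: for a.e. `v ∈ S¹` the radial limit of `u`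
at `v` is `c v`. -/
def IsTraceRep (u c : E2 → X) : Prop :=
  ∀ᵐ v ∂((μH[1] : Measure E2).restrict unitCircle),
    Filter.Tendsto (fun t : ℝ => u (t • v)) (𝓝[<] (1:ℝ)) (𝓝 (c v))

/-- `c` (restricted to `S¹`) is a weakly monotone parametrization of the Jordan curve `Γ`:
a uniform limit of homeomorphisms `S¹ → Γ`. -/
def IsWeaklyMonotoneParam {Y : Type*} [MetricSpace Y] (c : E2 → Y) (Γ : Set Y) : Prop :=
  ContinuousOn c unitCircle ∧ (∀ v ∈ unitCircle, c v ∈ Γ) ∧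
    ∀ ε : ℝ, 0 < ε → ∃ h : ↥unitCircle ≃ₜ ↥Γ,
      ∀ v : ↥unitCircle, dist (c (v : E2)) ((h v : ↥Γ) : Y) < ε

/-- The family `Λ(Γ, X)` of Sobolev discs spanning the Jordan curve `Γ`. -/
def Lambda (Γ : Set X) : Set (E2 → X) :=
  {u | MemN12 unitDisc u ∧ ∃ c : E2 → X, IsWeaklyMonotoneParam c Γ ∧ IsTraceRep u c}

/-- The seminorm `s` is the approximate metric derivative of `u` at `z`:
`ap lim_{y → z} (d(u y, u z) - s(y-z)) / |y-z| = 0`. -/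
def HasApproxMetricDeriv (u : E2 → X) (z : E2) (s : Seminorm ℝ E2) : Prop :=
  ∀ ε : ℝ, 0 < ε →
    Filter.Tendsto
      (fun r : ℝ =>
        volume {y : E2 | y ∈ Metric.ball z r ∧
            ε * ‖y - z‖ ≤ |dist (u y) (u z) - s (y - z)|} / volume (Metric.ball z r))
      (𝓝[>] (0:ℝ)) (𝓝 0)

end Sobolev

open Classical in
/-- The Jacobian `J(s)` of a seminorm `s` on `ℝ²`: the Hausdorff 2-measure of the unit square
in `(ℝ², s)` when `s` is a norm (which equals `π / |{s ≤ 1}|`), and `0` otherwise. -/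
def seminormJacobian (s : Seminorm ℝ E2) : ℝ≥0∞ :=
  if ∃ v : E2, v ≠ 0 ∧ s v = 0 then 0
  else ENNReal.ofReal Real.pi / volume {v : E2 | s v ≤ 1}

/-- `u` is infinitesimally `K`-quasiconformal: `g_u(z)² ≤ K ⬝ J(md u_z)` for a.e. `z ∈ D`. -/
def InfinitesimallyQC {X : Type*} [MetricSpace X] (u : E2 → X) (K : ℝ≥0∞) : Prop :=
  ∃ g : E2 → ℝ≥0∞, IsMinimalWUG u g ∧
    ∀ᵐ z ∂(volume.restrict unitDisc),
      ∃ s : Seminorm ℝ E2, HasApproxMetricDeriv u z s ∧ g z ^ 2 ≤ K * seminormJacobian s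

/-- The parametrized (Hausdorff) area `Area(u) = ∫_D J(md u_z) dz`. -/
def parametrizedArea {X : Type*} [MetricSpace X] (u : E2 → X) : ℝ≥0∞ :=
  ∫⁻ z in unitDisc, ⨆ (s : Seminorm ℝ E2) (_ : HasApproxMetricDeriv u z s), seminormJacobian s

/-- The essential oscillation of `u` in the `δ`-ball around `z` (within the unit disc). -/
def essOsc {X : Type*} [MetricSpace X] (u : E2 → X) (z : E2) (δ : ℝ) : ℝ≥0∞ :=
  ⨅ (A : Set E2)
    (_ : A ⊆ unitDisc ∩ Metric.ball z δ ∧ volume ((unitDisc ∩ Metric.ball z δ) \ A) = 0),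
    EMetric.diam (u '' A)

/-- A quasisymmetric map between metric spaces. -/
def IsQuasisymmetric {M X : Type*} [MetricSpace M] [MetricSpace X] (u : M → X) : Prop :=
  ∃ η : ℝ≥0 ≃ₜ ℝ≥0, ∀ z a b : M, ∀ t : ℝ≥0,
    dist z a ≤ (t : ℝ) * dist z b → dist (u z) (u a) ≤ (η t : ℝ) * dist (u z) (u b)

/-- A map `u` is quasisymmetric on a subset `S` of its domain. -/
def IsQuasisymmetricOn {M X : Type*} [MetricSpace M] [MetricSpace X] (u : M → X)
    (S : Set M) : Prop :=
  ∃ η : ℝ≥0 ≃ₜ ℝ≥0, ∀ z ∈ S, ∀ a ∈ S, ∀ b ∈ S, ∀ t : ℝ≥0,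
    dist z a ≤ (t : ℝ) * dist z b → dist (u z) (u a) ≤ (η t : ℝ) * dist (u z) (u b)

/-- A metric space is linearly locally connected. -/
def LinearlyLocallyConnected (X : Type*) [MetricSpace X] : Prop :=
  ∃ lam : ℝ, 1 ≤ lam ∧ ∀ (x : X) (r : ℝ), 0 < r →
    (∀ y ∈ Metric.ball x r, ∀ z ∈ Metric.ball x r, ∃ C : Set X, IsCompact C ∧ IsConnected C ∧
      y ∈ C ∧ z ∈ C ∧ C ⊆ Metric.ball x (lam * r)) ∧
    (∀ y ∉ Metric.ball x r, ∀ z ∉ Metric.ball x r, ∃ C : Set X, IsCompact C ∧ IsConnected C ∧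
      y ∈ C ∧ z ∈ C ∧ C ⊆ (Metric.ball x (r / lam))ᶜ)

/-- A subset `S` is `2`-rectifiable: up to an `H²`-null set, `S` is covered by countably many
Lipschitz images of subsets of `ℝ²`. -/
def Is2Rectifiable {X : Type*} [MetricSpace X] [MeasurableSpace X] [BorelSpace X]
    (S : Set X) : Prop :=
  ∃ (A : ℕ → Set E2) (f : ℕ → E2 → X), (∀ n, ∃ K : ℝ≥0, LipschitzOnWith K (f n) (A n)) ∧
    μH[2] (S \ ⋃ n, f n '' A n) = 0

/-- The boundary circle `∂X` of a space homeomorphic to the closed disc. -/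
def discBoundary {X : Type*} [TopologicalSpace X] (φ : ↥unitClosedDisc ≃ₜ X) : Set X :=
  {x : X | ((φ.symm x : ↥unitClosedDisc) : E2) ∈ unitCircle}

/-- `f` is biLipschitz on `S`. -/
def BiLipschitzOn {A X : Type*} [PseudoMetricSpace A] [PseudoMetricSpace X]
    (f : A → X) (S : Set A) : Prop :=
  ∃ K : ℝ≥0, 0 < K ∧ ∀ v ∈ S, ∀ w ∈ S,
    (K : ℝ)⁻¹ * dist v w ≤ dist (f v) (f w) ∧ dist (f v) (f w) ≤ (K : ℝ) * dist v w

/-- A biLipschitz curve: the image of a biLipschitz embedding of `S¹` or of an interval. -/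
def IsBiLipschitzCurve {X : Type*} [MetricSpace X] (T : Set X) : Prop :=
  (∃ f : E2 → X, BiLipschitzOn f unitCircle ∧ f '' unitCircle = T) ∨
  (∃ f : ℝ → X, BiLipschitzOn f (Set.Icc 0 1) ∧ f '' Set.Icc 0 1 = T)

/-- `T` is a Jordan arc intersecting the set `B` exactly at its two endpoints. -/
def IsJordanArcMeetingBoundaryAtEndpoints {X : Type*} [TopologicalSpace X] (T B : Set X) : Prop :=
  ∃ h : ↥(Set.Icc (0:ℝ) 1) ≃ₜ ↥T,
    T ∩ B = {((h ⟨0, Set.mem_Icc.mpr (by norm_num)⟩ : ↥T) : X),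
             ((h ⟨1, Set.mem_Icc.mpr (by norm_num)⟩ : ↥T) : X)}

/-- `c` is a continuous-representative-of-trace of `u` on the convex domain `W`, with respect to
radial approach from an interior point `p`. -/
def IsTraceRepOn {X : Type*} [MetricSpace X] (u c : E2 → X) (W : Set E2) (p : E2) : Prop :=
  ∀ᵐ w ∂((μH[1] : Measure E2).restrict (frontier W)),
    Filter.Tendsto (fun t : ℝ => u ((1 - t) • p + t • w)) (𝓝[<] (1:ℝ)) (𝓝 (c w))

/-- The induced length (inner) distance of a metric space. -/
def lengthDist {X : Type*} [MetricSpace X] (x y : X) : ℝ≥0∞ :=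
  ⨅ (γ : MCurve X) (_ : γ.toFun γ.a = x ∧ γ.toFun γ.b = y), γ.length

/-- An injective metric space: `1`-Lipschitz maps into it extend from subsets. -/
def IsInjectiveMetricSpace (E : Type*) [MetricSpace E] : Prop :=
  ∀ (Z : Type) [MetricSpace Z], ∀ (Y : Set Z) (f : ↥Y → E), LipschitzWith 1 f →
    ∃ F : Z → E, LipschitzWith 1 F ∧ ∀ y : ↥Y, F (y : Z) = f y

/-- A nowhere vanishing function on a simply connected space has a continuous logarithm. -/
theorem exists_continuous_log {Y : Type*} [TopologicalSpace Y] [SimplyConnectedSpace Y]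
    [LocallyPathConnectedSpace Y] {f : Y → ℂ} (hf : Continuous f) (h0 : ∀ y, f y ≠ 0) :
    ∃ L : Y → ℂ, Continuous L ∧ ∀ y, Complex.exp (L y) = f y := by
  obtain ⟨y₀⟩ : Nonempty Y := inferInstance
  obtain ⟨F, ⟨-, hF⟩, -⟩ := Complex.isCoveringMapOn_exp.existsUnique_continuousMap_lifts
    (⟨f, hf⟩ : C(Y, ℂ)) (a₀ := y₀) (e₀ := Complex.log (f y₀)) (Complex.exp_log (h0 y₀))
    (fun a => by simpa using h0 a)
  exact ⟨F, F.continuous, fun y => congrFun hF y⟩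

/-- Two continuous logarithms of the same function differ by a constant. -/
theorem sub_eq_sub_of_exp_eq {Y : Type*} [TopologicalSpace Y] {S : Set Y} (hS : IsPreconnected S)
    {L M : Y → ℂ} (hL : ContinuousOn L S) (hM : ContinuousOn M S)
    (h : ∀ y ∈ S, Complex.exp (L y) = Complex.exp (M y)) {x y : Y} (hx : x ∈ S) (hy : y ∈ S) :
    L x - M x = L y - M y := by
  have key : ∀ z ∈ S, ∃ n : ℤ, (L z - M z) / (2 * Real.pi * Complex.I) = n := by
    intro z hz
    obtain ⟨n, hn⟩ := Complex.exp_eq_exp_iff_exists_int.1 (h z hz)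
    refine ⟨n, ?_⟩
    rw [hn]
    field_simp [Complex.two_pi_I_ne_zero]
    ring
  choose! n hn using key
  have hc : ContinuousOn (fun z => ((n z : ℤ) : ℂ)) S :=
    ((hL.sub hM).div_const (2 * Real.pi * Complex.I)).congr fun z hz => (hn z hz).symm
  have hcn : ContinuousOn n S :=
    Int.isClosedEmbedding_coe_real.isInducing.continuousOn_iff.2
      ((Complex.continuous_re.comp_continuousOn hc).congr fun z _ => (Complex.intCast_re _).symm)
  have := hS.constant hcn hx hy
  have h1 := hn x hx
  rw [this, ← hn y hy] at h1
  exact (div_left_inj' Complex.two_pi_I_ne_zero).1 h1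

/-- The path `γ : [a, b] → ℂ` has a continuous logarithm, with increment `Δ`. -/
def HasLogIncrement (γ : ℝ → ℂ) (a b : ℝ) (Δ : ℂ) : Prop :=
  ∃ L : ℝ → ℂ, ContinuousOn L (Icc a b) ∧ (∀ t ∈ Icc a b, Complex.exp (L t) = γ t) ∧
    L b - L a = Δ

namespace HasLogIncrement

variable {γ δ : ℝ → ℂ} {a b c : ℝ} {Δ Δ' : ℂ}

theorem exists_of_ne_zero (hab : a ≤ b) (hγ : ContinuousOn γ (Icc a b))
    (h0 : ∀ t ∈ Icc a b, γ t ≠ 0) : ∃ Δ, HasLogIncrement γ a b Δ := by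
  obtain ⟨L, hL, hLe⟩ := exists_continuous_log (f := fun t => γ (projIcc a b hab t))
    (hγ.domRestrict.comp (continuous_projIcc)) (fun t => h0 _ (projIcc a b hab t).2)
  exact ⟨_, L, hL.continuousOn, fun t ht => by rw [hLe, projIcc_of_mem hab ht], rfl⟩

theorem unique (hab : a ≤ b) (h : HasLogIncrement γ a b Δ) (h' : HasLogIncrement γ a b Δ') :
    Δ = Δ' := by
  obtain ⟨L, hL, hLe, rfl⟩ := h
  obtain ⟨M, hM, hMe, rfl⟩ := h'
  have := sub_eq_sub_of_exp_eq isPreconnected_Icc hL hM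
    (fun t ht => (hLe t ht).trans (hMe t ht).symm) (left_mem_Icc.2 hab) (right_mem_Icc.2 hab)
  linear_combination -this

theorem exp_eq (hab : a ≤ b) (h : HasLogIncrement γ a b Δ) : Complex.exp Δ = γ b / γ a := by
  obtain ⟨L, -, hLe, rfl⟩ := h
  rw [Complex.exp_sub, hLe b (right_mem_Icc.2 hab), hLe a (left_mem_Icc.2 hab)]

theorem congr (h : HasLogIncrement γ a b Δ) (e : EqOn δ γ (Icc a b)) :
    HasLogIncrement δ a b Δ := by
  obtain ⟨L, hL, hLe, rfl⟩ := h
  exact ⟨L, hL, fun t ht => (hLe t ht).trans (e ht).symm, rfl⟩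

theorem mul_slitPlane (h : HasLogIncrement γ a b Δ) {u : ℝ → ℂ}
    (hu : ContinuousOn u (Icc a b)) (hs : ∀ t ∈ Icc a b, u t ∈ Complex.slitPlane) :
    HasLogIncrement (fun t => γ t * u t) a b (Δ + (Complex.log (u b) - Complex.log (u a))) := by
  obtain ⟨L, hL, hLe, rfl⟩ := h
  refine ⟨fun t => L t + Complex.log (u t), hL.add (hu.clog hs), fun t ht => ?_, by ring⟩
  rw [Complex.exp_add, hLe t ht, Complex.exp_log (Complex.slitPlane_ne_zero (hs t ht))]

theorem const {z : ℂ} (hz : z ≠ 0) : HasLogIncrement (fun _ => z) a b 0 :=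
  ⟨fun _ => Complex.log z, continuousOn_const, fun _ _ => Complex.exp_log hz, sub_self _⟩

theorem of_slitPlane {u : ℝ → ℂ}
    (hu : ContinuousOn u (Icc a b)) (hs : ∀ t ∈ Icc a b, u t ∈ Complex.slitPlane) :
    HasLogIncrement u a b (Complex.log (u b) - Complex.log (u a)) := by
  simpa using (const (a := a) (b := b) one_ne_zero).mul_slitPlane hu hs

/-- A small perturbation changes the logarithmic increment in a controlled way. -/
theorem perturb (h : HasLogIncrement γ a b Δ) (hγ : ContinuousOn γ (Icc a b))
    (hδ : ContinuousOn δ (Icc a b)) (hd : ∀ t ∈ Icc a b, ‖δ t - γ t‖ < ‖γ t‖) :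
    HasLogIncrement δ a b (Δ + (Complex.log (δ b / γ b) - Complex.log (δ a / γ a))) := by
  have h0 : ∀ t ∈ Icc a b, γ t ≠ 0 := fun t ht h => by
    have := hd t ht
    rw [h, norm_zero] at this
    exact (norm_nonneg _).not_gt this
  refine (h.mul_slitPlane (u := fun t => δ t / γ t) (hδ.div hγ h0) fun t ht => ?_).congr
    fun t ht => (mul_div_cancel₀ _ (h0 t ht)).symm
  apply Complex.ball_one_subset_slitPlane
  rw [mem_ball, dist_eq_norm, div_sub_one (h0 t ht), norm_div]
  exact (div_lt_one (norm_pos_iff.2 (h0 t ht))).2 (hd t ht)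

theorem trans (hab : a ≤ b) (hbc : b ≤ c) (h : HasLogIncrement γ a b Δ)
    (h' : HasLogIncrement γ b c Δ') : HasLogIncrement γ a c (Δ + Δ') := by
  obtain ⟨L, hL, hLe, rfl⟩ := h
  obtain ⟨M, hM, hMe, rfl⟩ := h'
  have hb : Complex.exp (L b) = Complex.exp (M b) := by
    rw [hLe b (right_mem_Icc.2 hab), hMe b (left_mem_Icc.2 hbc)]
  have e1 : EqOn (fun t => if t ≤ b then L t else M t - M b + L b) L (Icc a b) :=
    fun t ht => if_pos ht.2
  have e2 : EqOn (fun t => if t ≤ b then L t else M t - M b + L b)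
      (fun t => M t - M b + L b) (Icc b c) := by
    intro t ht
    by_cases h : t ≤ b
    · obtain rfl := le_antisymm h ht.1
      simp
    · simp [h]
  refine ⟨fun t => if t ≤ b then L t else M t - M b + L b, ?_, fun t ht => ?_, ?_⟩
  · rw [← Icc_union_Icc_eq_Icc hab hbc]
    exact (hL.congr e1).union_of_isClosed
      (((hM.sub continuousOn_const).add continuousOn_const).congr e2) isClosed_Icc isClosed_Icc
  · rcases le_total t b with h | h
    · rw [e1 ⟨ht.1, h⟩, hLe t ⟨ht.1, h⟩]
    · rw [e2 ⟨h, ht.2⟩]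
      simp only
      rw [Complex.exp_add, Complex.exp_sub, ← hb, div_mul_cancel₀ _ (Complex.exp_ne_zero _),
        hMe t ⟨h, ht.2⟩]
  · rw [e2 (right_mem_Icc.2 hbc), e1 (left_mem_Icc.2 hab)]
    ring

theorem comp {f : ℝ → ℝ} {c d : ℝ} (h : HasLogIncrement γ a b Δ) (hf : ContinuousOn f (Icc c d))
    (hm : MapsTo f (Icc c d) (Icc a b)) (hc : f c = a) (hd : f d = b) :
    HasLogIncrement (γ ∘ f) c d Δ := by
  obtain ⟨L, hL, hLe, rfl⟩ := h
  exact ⟨L ∘ f, hL.comp hf hm, fun t ht => hLe _ (hm ht), by simp [hc, hd]⟩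

theorem comp_reverse {f : ℝ → ℝ} {c d : ℝ} (h : HasLogIncrement γ a b Δ)
    (hf : ContinuousOn f (Icc c d)) (hm : MapsTo f (Icc c d) (Icc a b)) (hc : f c = b)
    (hd : f d = a) : HasLogIncrement (γ ∘ f) c d (-Δ) := by
  obtain ⟨L, hL, hLe, rfl⟩ := h
  exact ⟨L ∘ f, hL.comp hf hm, fun t ht => hLe _ (hm ht), by simp [hc, hd]⟩

/-- The increments of the logarithm of a nowhere vanishing function on a rectangle around the
boundary of the rectangle cancel. -/
theorem add_eq_add_of_rectangle {f : ℝ → ℝ → ℂ} {c d : ℝ} (hab : a ≤ b) (hcd : c ≤ d)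
    (hf : ContinuousOn (fun p : ℝ × ℝ => f p.1 p.2) (Icc a b ×ˢ Icc c d))
    (h0 : ∀ s ∈ Icc a b, ∀ t ∈ Icc c d, f s t ≠ 0) {Δ₁ Δ₂ Δ₃ Δ₄ : ℂ}
    (h₁ : HasLogIncrement (fun s => f s c) a b Δ₁) (h₂ : HasLogIncrement (f b) c d Δ₂)
    (h₃ : HasLogIncrement (fun s => f s d) a b Δ₃) (h₄ : HasLogIncrement (f a) c d Δ₄) :
    Δ₁ + Δ₂ = Δ₄ + Δ₃ := by
  obtain ⟨L, hL, hLe⟩ := exists_continuous_log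
    (f := fun p : ℝ × ℝ => f (projIcc a b hab p.1) (projIcc c d hcd p.2))
    (hf.comp_continuous (f := fun p : ℝ × ℝ =>
        (((projIcc a b hab p.1 : ℝ), (projIcc c d hcd p.2 : ℝ)) : ℝ × ℝ))
      (by fun_prop) (fun p => ⟨(projIcc a b hab p.1).2, (projIcc c d hcd p.2).2⟩))
    (fun p => h0 _ (projIcc a b hab p.1).2 _ (projIcc c d hcd p.2).2)
  have hor : ∀ t ∈ Icc c d, HasLogIncrement (fun s => f s t) a b (L (b, t) - L (a, t)) :=
    fun t ht => ⟨fun s => L (s, t), by fun_prop, fun s hs => by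
      rw [hLe, projIcc_of_mem hab hs, projIcc_of_mem hcd ht], rfl⟩
  have ver : ∀ s ∈ Icc a b, HasLogIncrement (f s) c d (L (s, d) - L (s, c)) :=
    fun s hs => ⟨fun t => L (s, t), by fun_prop, fun t ht => by
      rw [hLe, projIcc_of_mem hab hs, projIcc_of_mem hcd ht], rfl⟩
  rw [h₁.unique hab (hor c (left_mem_Icc.2 hcd)), h₂.unique hcd (ver b (right_mem_Icc.2 hab)),
    h₃.unique hab (hor d (right_mem_Icc.2 hcd)), h₄.unique hcd (ver a (left_mem_Icc.2 hab))]
  ring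

/-- The increment of the logarithm along a circle. -/
theorem circle {r : ℝ} (hr : 0 < r) :
    HasLogIncrement (fun t => r * Complex.exp (t * Complex.I)) 0 (2 * Real.pi)
      (2 * Real.pi * Complex.I) := by
  refine ⟨fun t => Real.log r + t * Complex.I, by fun_prop, fun t _ => ?_, by push_cast; ring⟩
  rw [Complex.exp_add, ← Complex.ofReal_exp, Real.exp_log hr]

end HasLogIncrement

/-- The frontier of a bounded plane set is not contained in an arc. -/
theorem not_frontier_subset_arc {c : ℝ → ℂ} {a b : ℝ} (hab : a ≤ b)
    (hc : ContinuousOn c (Icc a b)) (hinj : InjOn c (Icc a b)) {U : Set ℂ}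
    (hU : Bornology.IsBounded U) {w : ℂ} (hw : w ∈ U) (hwc : ∀ t ∈ Icc a b, c t ≠ w) :
    ¬ frontier U ⊆ c '' Icc a b := by
  classical
  intro hfr
  obtain ⟨-, L, hL, hLe, -⟩ := HasLogIncrement.exists_of_ne_zero hab
    (hc.sub (continuousOn_const (c := w))) (fun t ht => sub_ne_zero.2 (hwc t ht))
  obtain ⟨F, hF⟩ := ContinuousMap.exists_extension (e := (Icc a b).domRestrict c)
    (hc.domRestrict.isClosedEmbedding (injOn_iff_injective.1 hinj))
    (⟨_, hL.domRestrict⟩ : C(Icc a b, ℂ))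
  have hFe : ∀ t ∈ Icc a b, F (c t) = L t := fun t ht =>
    DFunLike.congr_fun hF (⟨t, ht⟩ : Icc a b)
  obtain ⟨H, hH, hHe⟩ := exists_continuous_log
    (f := fun z => if z ∈ U then Complex.exp (F z) else z - w)
    (Continuous.if (fun z hz => by
        obtain ⟨t, ht, rfl⟩ := hfr hz
        rw [hFe t ht, hLe t ht]
        rfl)
      (by fun_prop) (by fun_prop))
    (fun z => by
      split_ifs with h
      · exact Complex.exp_ne_zero _
      · exact sub_ne_zero.2 fun e => h (e ▸ hw))
  obtain ⟨R, hR, hUR⟩ := hU.subset_ball_lt 0 w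
  have hlog : HasLogIncrement (fun t => R * Complex.exp (t * Complex.I)) 0 (2 * Real.pi) 0 := by
    refine ⟨fun t => H (w + R * Complex.exp (t * Complex.I)), by fun_prop, fun t _ => ?_, ?_⟩
    · rw [hHe, if_neg, add_sub_cancel_left]
      intro h
      have := hUR h
      rw [mem_ball, dist_eq_norm, add_sub_cancel_left, norm_mul, Complex.norm_exp_ofReal_mul_I,
        Complex.norm_real, Real.norm_of_nonneg hR.le, mul_one] at this
      exact lt_irrefl _ this
    · simp
  exact Complex.two_pi_I_ne_zero
    ((HasLogIncrement.circle hR).unique Real.two_pi_pos.le hlog)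

/-- A point around which a closed path has nonzero increment of the logarithm is separated by
the path from the complement of any disc around the point containing the path. -/
theorem connectedComponentIn_subset_ball {γ : ℝ → ℂ} {a b R : ℝ} {w Δ : ℂ} (hab : a ≤ b)
    (hγ : ContinuousOn γ (Icc a b)) (hclosed : γ a = γ b)
    (hR : ∀ t ∈ Icc a b, γ t ∈ ball w R) (hΔ : HasLogIncrement (fun t => γ t - w) a b Δ)
    (hΔ0 : Δ ≠ 0) : connectedComponentIn (γ '' Icc a b)ᶜ w ⊆ ball w R := by
  intro q hq
  by_contra hqR
  have hopen : IsOpen (γ '' Icc a b)ᶜ := (isCompact_Icc.image_of_continuousOn hγ).isClosed.isOpen_compl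
  have hw : w ∈ (γ '' Icc a b)ᶜ := connectedComponentIn_nonempty_iff.1 ⟨q, hq⟩
  have hpc : IsPathConnected (connectedComponentIn (γ '' Icc a b)ᶜ w) :=
    hopen.connectedComponentIn.isConnected_iff_isPathConnected.1
      (isConnected_connectedComponentIn_iff.2 hw)
  obtain ⟨σ, hσ⟩ := hpc.joinedIn w (mem_connectedComponentIn hw) q hq
  have hσ' : ∀ s t, t ∈ Icc a b → γ t - σ.extend s ≠ 0 := fun s t ht h =>
    connectedComponentIn_subset _ _ (hσ (projIcc 0 1 zero_le_one s))
      ⟨t, ht, sub_eq_zero.1 h⟩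
  have hq0 : ∀ t ∈ Icc a b, (γ t - q) / (w - q) ∈ Complex.slitPlane := by
    intro t ht
    have hwq : R ≤ ‖w - q‖ := by
      rw [← dist_eq_norm, dist_comm]
      exact not_lt.1 hqR
    have hd := hR t ht
    rw [mem_ball, dist_eq_norm] at hd
    have hwq0 : w - q ≠ 0 := norm_pos_iff.1 (lt_of_le_of_lt (norm_nonneg _) (hd.trans_le hwq))
    apply Complex.ball_one_subset_slitPlane
    rw [mem_ball, dist_eq_norm, div_sub_one hwq0, norm_div, sub_sub_sub_cancel_right]
    exact (div_lt_one (norm_pos_iff.2 hwq0)).2 (hd.trans_le hwq)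
  have hwq0 : w - q ≠ 0 := fun h => Complex.slitPlane_ne_zero
    (hq0 a (left_mem_Icc.2 hab)) (by simp [h])
  have h3 : HasLogIncrement (fun t => γ t - q) a b 0 := by
    have := ((HasLogIncrement.const (a := a) (b := b) hwq0).mul_slitPlane
      (u := fun t => (γ t - q) / (w - q)) (by fun_prop) hq0)
    rw [← hclosed, sub_self, add_zero] at this
    exact this.congr fun t _ => (mul_div_cancel₀ _ hwq0).symm
  obtain ⟨Δ', h2⟩ := HasLogIncrement.exists_of_ne_zero (zero_le_one' ℝ)
    (γ := fun s => γ a - σ.extend s) (by fun_prop) (fun s _ => hσ' s a (left_mem_Icc.2 hab))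
  have := HasLogIncrement.add_eq_add_of_rectangle (f := fun t s => γ t - σ.extend s) hab
    (zero_le_one' ℝ) ((hγ.comp continuousOn_fst fun p hp => hp.1).sub (by fun_prop))
    (fun t ht s _ => hσ' s t ht) (Δ₁ := Δ) (Δ₂ := Δ') (Δ₃ := 0) (Δ₄ := Δ') (by simpa using hΔ)
    (by simpa [hclosed] using h2) (by simpa using h3) h2
  exact hΔ0 (by linear_combination this)

/-- The component of the complement of a plane Jordan curve containing a point around which the
curve winds has the whole curve as its frontier. -/
theorem frontier_connectedComponentIn_eq {γ : ℝ → ℂ} {a b R : ℝ} {w Δ : ℂ} (hab : a < b)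
    (hγ : ContinuousOn γ (Icc a b)) (hclosed : γ a = γ b) (hinj : InjOn γ (Ico a b))
    (hR : ∀ t ∈ Icc a b, γ t ∈ ball w R) (hw : ∀ t ∈ Icc a b, γ t ≠ w)
    (hΔ : HasLogIncrement (fun t => γ t - w) a b Δ) (hΔ0 : Δ ≠ 0) :
    frontier (connectedComponentIn (γ '' Icc a b)ᶜ w) = γ '' Icc a b := by
  set T := γ '' Icc a b with hT
  set Ω := connectedComponentIn Tᶜ w with hΩ
  have hTc : IsClosed T := (isCompact_Icc.image_of_continuousOn hγ).isClosed
  have hwT : w ∈ Tᶜ := fun ⟨t, ht, h⟩ => hw t ht h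
  have hΩo : IsOpen Ω := hTc.isOpen_compl.connectedComponentIn
  have hΩb : Bornology.IsBounded Ω := isBounded_ball.subset
    (connectedComponentIn_subset_ball hab.le hγ hclosed hR hΔ hΔ0)
  have hwΩ : w ∈ Ω := mem_connectedComponentIn hwT
  have hsub : frontier Ω ⊆ T := by
    intro z hz
    by_contra hzT
    have hzo : IsOpen (connectedComponentIn Tᶜ z) := hTc.isOpen_compl.connectedComponentIn
    obtain ⟨y, hy1, hy2⟩ := mem_closure_iff.1 hz.1 _ hzo (mem_connectedComponentIn hzT)
    have : connectedComponentIn Tᶜ z = Ω :=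
      (connectedComponentIn_eq hy1).trans (connectedComponentIn_eq hy2).symm
    rw [hΩo.frontier_eq] at hz
    exact hz.2 (this ▸ mem_connectedComponentIn hzT)
  refine hsub.antisymm ?_
  rintro _ ⟨t₀, ht₀, rfl⟩
  by_contra hfr
  have hev : ∀ s ∈ Icc a b, γ s = γ t₀ → ∃ δ > 0, ∀ t ∈ Icc a b, |t - s| < δ → γ t ∉ frontier Ω := by
    intro s hs hst
    have : ∀ᶠ t in 𝓝[Icc a b] s, γ t ∉ frontier Ω :=
      (hγ s hs).eventually (isClosed_frontier.isOpen_compl.mem_nhds (by rwa [hst]))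
    obtain ⟨δ, hδ, h⟩ := Metric.mem_nhdsWithin_iff.1 this
    exact ⟨δ, hδ, fun t ht hd => h ⟨by rwa [mem_ball, Real.dist_eq], ht⟩⟩
  have hends : t₀ = a ∨ t₀ = b → False := by
    intro h
    have hat : γ a = γ t₀ := by rcases h with rfl | rfl <;> simp [hclosed]
    obtain ⟨δ, hδ, h1⟩ := hev a (left_mem_Icc.2 hab.le) hat
    obtain ⟨δ', hδ', h2⟩ := hev b (right_mem_Icc.2 hab.le) (hclosed ▸ hat)
    obtain ⟨η, hη, hηl⟩ := exists_between (lt_min (lt_min hδ hδ') (half_pos (sub_pos.2 hab)))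
    have hη1 : η < δ := hηl.trans_le ((min_le_left _ _).trans (min_le_left _ _))
    have hη2 : η < δ' := hηl.trans_le ((min_le_left _ _).trans (min_le_right _ _))
    have hη3 : η < (b - a) / 2 := hηl.trans_le (min_le_right _ _)
    have hss : Icc (a + η) (b - η) ⊆ Ico a b := fun t ht => ⟨by linarith [ht.1], by linarith [ht.2]⟩
    refine not_frontier_subset_arc (a := a + η) (b := b - η) (by linarith)
      (hγ.mono (hss.trans Ico_subset_Icc_self)) (hinj.mono hss) hΩb hwΩ
      (fun t ht => hw t (Ico_subset_Icc_self (hss ht))) fun z hz => ?_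
    obtain ⟨t, ht, rfl⟩ := hsub hz
    refine ⟨t, ⟨?_, ?_⟩, rfl⟩
    · by_contra hlt
      exact h1 t ht (abs_lt.2 ⟨by linarith [ht.1], by linarith⟩) hz
    · by_contra hlt
      exact h2 t ht (abs_lt.2 ⟨by linarith, by linarith [ht.2]⟩) hz
  have hta : a < t₀ := lt_of_le_of_ne ht₀.1 fun h => hends (Or.inl h.symm)
  have htb : t₀ < b := lt_of_le_of_ne ht₀.2 fun h => hends (Or.inr h)
  obtain ⟨δ, hδ, h1⟩ := hev t₀ ht₀ rfl
  obtain ⟨η, hη, hηl⟩ := exists_between (lt_min hδ (lt_min (sub_pos.2 hta) (sub_pos.2 htb)))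
  have hη1 : η < δ := hηl.trans_le (min_le_left _ _)
  have hη2 : η < t₀ - a := hηl.trans_le ((min_le_right _ _).trans (min_le_left _ _))
  have hη3 : η < b - t₀ := hηl.trans_le ((min_le_right _ _).trans (min_le_right _ _))
  set c : ℝ → ℂ := fun t => if t ≤ b then γ t else γ (t - (b - a)) with hcdef
  have e1 : ∀ t ≤ b, c t = γ t := fun t ht => if_pos ht
  have e2 : ∀ t, b ≤ t → c t = γ (t - (b - a)) := by
    intro t ht
    rcases ht.eq_or_lt with rfl | h
    · rw [e1 _ le_rfl, ← hclosed]
      congr 1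
      ring
    · exact if_neg h.not_ge
  have hc : ContinuousOn c (Icc a (b + (b - a))) := by
    rw [← Icc_union_Icc_eq_Icc hab.le (by linarith : b ≤ b + (b - a))]
    refine (hγ.congr fun t ht => e1 t ht.2).union_of_isClosed
      (ContinuousOn.congr (f := fun t => γ (t - (b - a))) ?_ fun t ht => e2 t ht.1)
      isClosed_Icc isClosed_Icc
    exact hγ.comp (by fun_prop) fun t ht => ⟨by linarith [ht.1], by linarith [ht.2]⟩
  have hcw : ∀ t ∈ Icc a (b + (b - a)), c t ≠ w := by
    intro t ht
    rcases le_total t b with h | h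
    · rw [e1 t h]; exact hw t ⟨ht.1, h⟩
    · rw [e2 t h]; exact hw _ ⟨by linarith, by linarith [ht.2]⟩
  have hcross : ∀ s t, t₀ + η ≤ s → s < b → b ≤ t → t ≤ t₀ + (b - a) - η → c s ≠ c t := by
    intro s t hs hsb hbt ht h
    rw [e1 s hsb.le, e2 t hbt] at h
    have := hinj ⟨by linarith, hsb⟩ ⟨by linarith, by linarith⟩ h
    linarith
  have hcinj : InjOn c (Icc (t₀ + η) (t₀ + (b - a) - η)) := by
    intro s hs t ht h
    rcases lt_or_ge s b with hsb | hsb <;> rcases lt_or_ge t b with htb' | htb'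
    · rw [e1 s hsb.le, e1 t htb'.le] at h
      exact hinj ⟨by linarith [hs.1], hsb⟩ ⟨by linarith [ht.1], htb'⟩ h
    · exact (hcross s t hs.1 hsb htb' ht.2 h).elim
    · exact (hcross t s ht.1 htb' hsb hs.2 h.symm).elim
    · rw [e2 s hsb, e2 t htb'] at h
      have := hinj ⟨by linarith, by linarith [hs.2]⟩ ⟨by linarith, by linarith [ht.2]⟩ h
      linarith
  have hss : Icc (t₀ + η) (t₀ + (b - a) - η) ⊆ Icc a (b + (b - a)) :=
    fun t ht => ⟨by linarith [ht.1], by linarith [ht.2]⟩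
  refine not_frontier_subset_arc (by linarith) (hc.mono hss) hcinj hΩb hwΩ
    (fun t ht => hcw t (hss ht)) fun z hz => ?_
  obtain ⟨t, ht, rfl⟩ := hsub hz
  rcases le_or_gt (t₀ + η) t with h | h
  · exact ⟨t, ⟨h, by linarith [ht.2]⟩, e1 t ht.2⟩
  · have hlt : t ≤ t₀ - η := by
      by_contra hlt
      exact h1 t ht (abs_lt.2 ⟨by linarith, by linarith⟩) hz
    refine ⟨t + (b - a), ⟨by linarith [ht.1], by linarith⟩, ?_⟩
    rw [e2 _ (by linarith [ht.1]), add_sub_cancel_right]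

/-- A curve whose length is the distance of its endpoints can be reparametrized by arc length. -/
theorem MCurve.exists_dist_le_of_length_eq {X : Type*} [MetricSpace X] (γ : MCurve X)
    (hγ : γ.length = edist (γ.toFun γ.a) (γ.toFun γ.b)) :
    ∃ c : ℝ → X, c 0 = γ.toFun γ.a ∧ c (dist (γ.toFun γ.a) (γ.toFun γ.b)) = γ.toFun γ.b ∧
      ∀ s ∈ Icc 0 (dist (γ.toFun γ.a) (γ.toFun γ.b)),
      ∀ t ∈ Icc 0 (dist (γ.toFun γ.a) (γ.toFun γ.b)), dist (c s) (c t) ≤ |s - t| := by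
  obtain ⟨a, b, hab, f, hf⟩ := γ
  simp only [MCurve.length] at hγ ⊢
  have key : ∀ s t, a ≤ s → s ≤ t → t ≤ b →
      dist (f s) (f t) ≤ dist (f a) (f t) - dist (f a) (f s) := by
    intro s t has hst htb
    have h1 : edist (f a) (f s) + edist (f s) (f t) + edist (f t) (f b) ≤ edist (f a) (f b) := by
      rw [← hγ]
      have e1 := eVariationOn.Icc_add_Icc f (has.trans hst) htb (s := univ) (mem_univ _)
      have e2 := eVariationOn.Icc_add_Icc f has hst (s := univ) (mem_univ _)
      simp only [univ_inter] at e1 e2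
      rw [← e1, ← e2]
      gcongr
      · exact eVariationOn.edist_le f (left_mem_Icc.2 has) (right_mem_Icc.2 has)
      · exact eVariationOn.edist_le f (left_mem_Icc.2 hst) (right_mem_Icc.2 hst)
      · exact eVariationOn.edist_le f (left_mem_Icc.2 htb) (right_mem_Icc.2 htb)
    have h2 : dist (f a) (f s) + dist (f s) (f t) + dist (f t) (f b) ≤ dist (f a) (f b) := by
      simp only [edist_dist] at h1
      rwa [← ENNReal.ofReal_add dist_nonneg dist_nonneg, ← ENNReal.ofReal_add (by positivity)
        dist_nonneg, ENNReal.ofReal_le_ofReal_iff dist_nonneg] at h1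
    linarith [dist_triangle (f a) (f t) (f b)]
  have key' : ∀ s ∈ Icc a b, ∀ t ∈ Icc a b,
      dist (f s) (f t) ≤ |dist (f a) (f s) - dist (f a) (f t)| := by
    intro s hs t ht
    rcases le_total s t with h | h
    · rw [abs_sub_comm]
      exact (key s t hs.1 h ht.2).trans (le_abs_self _)
    · rw [dist_comm]
      exact (key t s ht.1 h hs.2).trans (le_abs_self _)
  have hsurj : ∀ v ∈ Icc 0 (dist (f a) (f b)), ∃ t ∈ Icc a b, dist (f a) (f t) = v := by
    intro v hv
    have := intermediate_value_Icc hab 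
      ((continuous_const.dist continuous_id).comp_continuousOn hf :
        ContinuousOn (fun t => dist (f a) (f t)) (Icc a b))
    simp only [Function.comp_def, id, dist_self] at this
    exact this hv
  choose! u hu huv using hsurj
  refine ⟨fun v => f (u v), ?_, ?_, fun s hs t ht => ?_⟩
  · have h0 : (0 : ℝ) ∈ Icc 0 (dist (f a) (f b)) := ⟨le_rfl, dist_nonneg⟩
    exact (dist_eq_zero.1 (huv 0 h0)).symm
  · have h0 : dist (f a) (f b) ∈ Icc 0 (dist (f a) (f b)) := ⟨dist_nonneg, le_rfl⟩
    have := key' _ (hu _ h0) b (right_mem_Icc.2 hab)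
    rw [huv _ h0, sub_self, abs_zero] at this
    exact dist_le_zero.1 this
  · have := key' _ (hu s hs) _ (hu t ht)
    rwa [huv s hs, huv t ht] at this

/-- In a compact locally geodesic space, geodesics between nearby points exist uniformly. -/
theorem IsLocallyGeodesicSpace.exists_uniform {X : Type*} [MetricSpace X] [CompactSpace X]
    (hX : IsLocallyGeodesicSpace X) : ∃ r > 0, ∀ y z : X, dist y z < r →
      ∃ c : ℝ → X, c 0 = y ∧ c (dist y z) = z ∧ ∀ s ∈ Icc 0 (dist y z),
        ∀ t ∈ Icc 0 (dist y z), dist (c s) (c t) ≤ |s - t| := by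
  choose U hU hUg using hX
  obtain ⟨r, hr, h⟩ := lebesgue_number_lemma_of_metric (isCompact_univ (X := X))
    (fun x => isOpen_interior (s := U x))
    (fun x _ => mem_iUnion.2 ⟨x, mem_interior_iff_mem_nhds.2 (hU x)⟩)
  refine ⟨r, hr, fun y z hyz => ?_⟩
  obtain ⟨x, hx⟩ := h y (mem_univ _)
  obtain ⟨γ, rfl, rfl, hl⟩ := hUg x y (interior_subset (hx (mem_ball_self hr))) z
    (interior_subset (hx (mem_ball'.2 hyz)))
  exact γ.exists_dist_le_of_length_eq hl

/-- A path of speed at most `1`, which has speed at most `η` where `G > 1`. -/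
def IsSlowPath {X : Type*} [MetricSpace X] (G : X → ℝ) (η : ℝ) (f : ℝ → X) (a b : ℝ) : Prop :=
  ∀ s t, a ≤ s → s ≤ t → t ≤ b → dist (f s) (f t) ≤ t - s ∧
    ((∀ u ∈ Icc s t, 1 < G (f u)) → dist (f s) (f t) ≤ η * (t - s))

namespace IsSlowPath

variable {X : Type*} [MetricSpace X] {G : X → ℝ} {η : ℝ} {f g : ℝ → X} {a b c : ℝ}

theorem dist_le (h : IsSlowPath G η f a b) {s t : ℝ} (hs : s ∈ Icc a b) (ht : t ∈ Icc a b) :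
    dist (f s) (f t) ≤ |s - t| := by
  rcases le_total s t with h' | h'
  · rw [abs_sub_comm]
    exact (h s t hs.1 h' ht.2).1.trans (le_abs_self _)
  · rw [dist_comm]
    exact (h t s ht.1 h' hs.2).1.trans (le_abs_self _)

theorem continuousOn (h : IsSlowPath G η f a b) : ContinuousOn f (Icc a b) :=
  (LipschitzOnWith.of_dist_le_mul (K := 1) fun s hs t ht => by
    simpa [Real.dist_eq] using h.dist_le hs ht).continuousOn

theorem of_dist_le (h1 : η ≤ 1)
    (h : ∀ s ∈ Icc a b, ∀ t ∈ Icc a b, dist (f s) (f t) ≤ η * |s - t|) : IsSlowPath G η f a b := by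
  intro s t hs hst ht
  have := h s ⟨hs, hst.trans ht⟩ t ⟨hs.trans hst, ht⟩
  rw [abs_sub_comm, abs_of_nonneg (sub_nonneg.2 hst)] at this
  exact ⟨this.trans (mul_le_of_le_one_left (sub_nonneg.2 hst) h1), fun _ => this⟩

theorem mono (h : IsSlowPath G η f a b) {a' b' : ℝ} (ha : a ≤ a') (hb : b' ≤ b) :
    IsSlowPath G η f a' b' :=
  fun s t hs hst ht => h s t (ha.trans hs) hst (ht.trans hb)

theorem congr (h : IsSlowPath G η f a b) (e : EqOn g f (Icc a b)) : IsSlowPath G η g a b := by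
  intro s t hs hst ht
  rw [e ⟨hs, hst.trans ht⟩, e ⟨hs.trans hst, ht⟩]
  exact ⟨(h s t hs hst ht).1, fun H => (h s t hs hst ht).2 fun u hu => by
    rw [← e ⟨hs.trans hu.1, hu.2.trans ht⟩]; exact H u hu⟩

theorem trans (h : IsSlowPath G η f a b) (h' : IsSlowPath G η f b c) :
    IsSlowPath G η f a c := by
  intro s t hs hst ht
  rcases le_total t b with htb | hbt
  · exact h s t hs hst htb
  rcases le_total b s with hbs | hsb
  · exact h' s t hbs hst ht
  obtain ⟨h1, h2⟩ := h s b hs hsb le_rfl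
  obtain ⟨h3, h4⟩ := h' b t le_rfl hbt ht
  have h5 := dist_triangle (f s) (f b) (f t)
  exact ⟨by linarith, fun H => by
    linarith [h2 fun u hu => H u ⟨hu.1, hu.2.trans hbt⟩, h4 fun u hu => H u ⟨hsb.trans hu.1, hu.2⟩]⟩

theorem comp_add (h : IsSlowPath G η f a b) (d : ℝ) :
    IsSlowPath G η (fun t => f (t + d)) (a - d) (b - d) := by
  intro s t hs hst ht
  have := h (s + d) (t + d) (by linarith) (by linarith) (by linarith)
  rw [add_sub_add_right_eq_sub] at this
  exact ⟨this.1, fun H => this.2 fun u hu => by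
    simpa using H (u - d) ⟨by linarith [hu.1], by linarith [hu.2]⟩⟩

theorem comp_neg (h : IsSlowPath G η f a b) :
    IsSlowPath G η (fun t => f (-t)) (-b) (-a) := by
  intro s t hs hst ht
  have := h (-t) (-s) (by linarith) (by linarith) (by linarith)
  rw [dist_comm, neg_sub_neg] at this
  exact ⟨this.1, fun H => this.2 fun u hu => by
    simpa using H (-u) ⟨by linarith [hu.2], by linarith [hu.1]⟩⟩

end IsSlowPath

/-- There is a slow path in `{G < 2}` from `x` to `y` of duration `T` along which the logarithm of
`g` has increment `Δ`. -/
def SlowJoined {X : Type*} [MetricSpace X] (G : X → ℝ) (η : ℝ) (g : X → ℂ) (x y : X) (T : ℝ)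
    (Δ : ℂ) : Prop :=
  ∃ f : ℝ → X, 0 ≤ T ∧ IsSlowPath G η f 0 T ∧ (∀ t ∈ Icc 0 T, G (f t) < 2) ∧
    HasLogIncrement (fun t => g (f t)) 0 T Δ ∧ f 0 = x ∧ f T = y

namespace SlowJoined

variable {X : Type*} [MetricSpace X] {G : X → ℝ} {η : ℝ} {g : X → ℂ} {x y z : X} {T T' : ℝ}
  {Δ Δ' : ℂ}

theorem of_isSlowPath {f : ℝ → X} {a b : ℝ} (hab : a ≤ b) (h : IsSlowPath G η f a b)
    (hG : ∀ t ∈ Icc a b, G (f t) < 2) (hΔ : HasLogIncrement (fun t => g (f t)) a b Δ) :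
    SlowJoined G η g (f a) (f b) (b - a) Δ := by
  refine ⟨fun t => f (t + a), sub_nonneg.2 hab, ?_, fun t ht => hG _ ⟨by linarith [ht.1],
    by linarith [ht.2]⟩, hΔ.comp (f := fun t => t + a) (by fun_prop) (fun t ht =>
      ⟨by linarith [ht.1], by linarith [ht.2]⟩) (by simp) (by simp), by simp, by simp⟩
  simpa using h.comp_add a

theorem symm (h : SlowJoined G η g x y T Δ) : SlowJoined G η g y x T (-Δ) := by
  obtain ⟨f, hT, hf, hG, hΔ, rfl, rfl⟩ := h
  have := of_isSlowPath (g := g) (neg_le_neg hT) hf.comp_neg (fun t ht => hG _ ⟨by linarith [ht.2],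
    by linarith [ht.1]⟩) (hΔ.comp_reverse (f := fun t => -t) (by fun_prop) (fun t ht =>
      ⟨by linarith [ht.2], by linarith [ht.1]⟩) (by simp) (by simp))
  simpa using this

theorem trans (h : SlowJoined G η g x y T Δ) (h' : SlowJoined G η g y z T' Δ') :
    SlowJoined G η g x z (T + T') (Δ + Δ') := by
  obtain ⟨f, hT, hf, hG, hΔ, rfl, rfl⟩ := h
  obtain ⟨k, hT', hk, hG', hΔ', hky, rfl⟩ := h'
  set p : ℝ → X := fun t => if t ≤ T then f t else k (t - T) with hp
  have e1 : EqOn p f (Icc 0 T) := fun t ht => if_pos ht.2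
  have e2 : EqOn p (fun t => k (t + -T)) (Icc T (T + T')) := by
    intro t ht
    rcases ht.1.eq_or_lt with rfl | h
    · simp [hp, hky]
    · simp [hp, h.not_ge, sub_eq_add_neg]
  have hTT : T ≤ T + T' := by linarith
  have hk' : IsSlowPath G η (fun t => k (t + -T)) T (T + T') := by
    have := hk.comp_add (-T)
    rwa [zero_sub, neg_neg, sub_neg_eq_add, add_comm T'] at this
  have hm : MapsTo (fun t => t + -T) (Icc T (T + T')) (Icc 0 T') :=
    fun t ht => ⟨by linarith [ht.1], by linarith [ht.2]⟩
  have hkΔ : HasLogIncrement (fun t => g (k (t + -T))) T (T + T') Δ' :=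
    hΔ'.comp (f := fun t => t + -T) (by fun_prop) hm (by simp) (by simp)
  refine ⟨p, by linarith, (hf.congr e1).trans (hk'.congr e2), fun t ht => ?_,
    (hΔ.congr fun t ht => by simp only [e1 ht]).trans hT hTT
      (hkΔ.congr fun t ht => by simp only [e2 ht]), e1 ⟨le_rfl, hT⟩, ?_⟩
  · rcases le_total t T with h | h
    · rw [e1 ⟨ht.1, h⟩]
      exact hG _ ⟨ht.1, h⟩
    · rw [e2 ⟨h, ht.2⟩]
      exact hG' _ (hm ⟨h, ht.2⟩)
  · rw [e2 ⟨hTT, le_rfl⟩]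
    simp

end SlowJoined

namespace IsSlowPath

variable {X : Type*} [MetricSpace X] {G : X → ℝ} {η : ℝ} {f g : ℝ → X} {a b c : ℝ}

theorem dist_le_of_Ioc (h : IsSlowPath G η f a b) (hη : 0 ≤ η) (hab : a ≤ b)
    (hG : ∀ u ∈ Ioc a b, 1 < G (f u)) : dist (f a) (f b) ≤ η * (b - a) := by
  rcases hab.eq_or_lt with rfl | hab
  · simp
  refine le_of_forall_pos_le_add fun e he => ?_
  obtain ⟨s, hs, hsl⟩ := exists_between (lt_min hab (lt_add_of_pos_right a he))
  have hsb : s < b := hsl.trans_le (min_le_left _ _)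
  have hse : s < a + e := hsl.trans_le (min_le_right _ _)
  have h1 := (h a s le_rfl hs.le hsb.le).1
  have h2 := (h s b hs.le hsb.le le_rfl).2 fun u hu => hG u ⟨hs.trans_le hu.1, hu.2⟩
  have h3 := dist_triangle (f a) (f s) (f b)
  have h4 : η * (b - s) ≤ η * (b - a) := by gcongr
  linarith

/-- A slow path of bounded duration which is not too short cannot reach `{2 ≤ G}`. -/
theorem lt_two (h : IsSlowPath G η f 0 c) (hGc : Continuous G) (hη : 0 ≤ η) {C s ℓ : ℝ}
    (hcC : c ≤ C) (hs : η * C < s) (hℓ : η * C < ℓ)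
    (hG : ∀ p q, G p ≤ 1 → 2 ≤ G q → s ≤ dist p q) (hf : ∃ t ∈ Icc 0 c, ℓ ≤ dist (f 0) (f t)) :
    ∀ t ∈ Icc 0 c, G (f t) < 2 := by
  have hle : ∀ d ≤ c, η * d ≤ η * C := fun d hd => by gcongr; exact hd.trans hcC
  intro t₁ ht₁
  by_contra! hlt
  have hcl : IsCompact (Icc 0 c ∩ (fun t => G (f t)) ⁻¹' Iic 1) :=
    isCompact_Icc.of_isClosed_subset
      ((hGc.comp_continuousOn h.continuousOn).preimage_isClosed_of_isClosed isClosed_Icc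
        isClosed_Iic) inter_subset_left
  rcases (Icc 0 c ∩ (fun t => G (f t)) ⁻¹' Iic 1).eq_empty_or_nonempty with hS | hS
  · obtain ⟨t, ht, hft⟩ := hf
    have := (h 0 t le_rfl ht.1 ht.2).2 fun u hu => by
      by_contra! hu1
      exact hS.subset ⟨⟨hu.1, hu.2.trans ht.2⟩, hu1⟩
    linarith [hle (t - 0) (by linarith [ht.2])]
  · obtain ⟨t₀, ⟨ht₀, hGt₀⟩, hmin⟩ := hcl.exists_isMinOn hS
      (f := fun t => |t - t₁|) (by fun_prop)
    have hgt : ∀ u ∈ Icc 0 c, |u - t₁| < |t₀ - t₁| → 1 < G (f u) := by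
      intro u hu hlt
      by_contra! hu1
      exact hlt.not_ge (hmin ⟨hu, hu1⟩)
    have hd := hG _ _ hGt₀ hlt
    rcases le_total t₀ t₁ with h01 | h01
    · have := (h.mono ht₀.1 ht₁.2).dist_le_of_Ioc hη h01 fun u hu =>
        hgt u ⟨ht₀.1.trans hu.1.le, hu.2.trans ht₁.2⟩ (by
          rw [abs_of_nonpos (by linarith [hu.2]), abs_of_nonpos (by linarith)]
          linarith [hu.1])
      linarith [hle (t₁ - t₀) (by linarith [ht₁.2, ht₀.1])]
    · have := (h.mono ht₁.1 ht₀.2).comp_neg.dist_le_of_Ioc hη (neg_le_neg h01) fun u hu =>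
        hgt (-u) ⟨by linarith [hu.2, ht₁.1], by linarith [hu.1, ht₀.2]⟩ (by
          rw [abs_of_nonneg (by linarith [hu.2]), abs_of_nonneg (by linarith)]
          linarith [hu.1])
      rw [neg_neg, neg_neg] at this
      linarith [hle (-t₁ - -t₀) (by linarith [ht₁.1, ht₀.2])]

/-- Slow paths are closed under uniform convergence. -/
theorem of_tendstoUniformlyOn {F : ℕ → ℝ → X} (hF : ∀ n, IsSlowPath G η (F n) a b)
    (hG : Continuous G) (hf : ContinuousOn f (Icc a b))
    (h : TendstoUniformlyOn F f atTop (Icc a b)) : IsSlowPath G η f a b := by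
  intro s t hs hst ht
  have hlim : Tendsto (fun n => dist (F n s) (F n t)) atTop (𝓝 (dist (f s) (f t))) :=
    (h.tendsto_at ⟨hs, hst.trans ht⟩).dist (h.tendsto_at ⟨hs.trans hst, ht⟩)
  refine ⟨le_of_tendsto' hlim fun n => (hF n s t hs hst ht).1, fun H => ?_⟩
  have hsub : Icc s t ⊆ Icc a b := Icc_subset_Icc hs ht
  obtain ⟨δ, hδ, hδs⟩ := (isCompact_Icc.image_of_continuousOn (hf.mono hsub)
    ).exists_thickening_subset_open (isOpen_lt continuous_const hG) (image_subset_iff.2 H)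
  refine le_of_tendsto hlim ?_
  filter_upwards [Metric.tendstoUniformlyOn_iff.1 h δ hδ] with n hn
  exact (hF n s t hs hst ht).2 fun u hu => hδs (mem_thickening_iff.2
    ⟨f u, mem_image_of_mem f hu, by rw [dist_comm]; exact hn u (hsub hu)⟩)

end IsSlowPath

/-- The logarithmic increment is continuous under uniform convergence. -/
theorem HasLogIncrement.tendsto {γ : ℝ → ℂ} {F : ℕ → ℝ → ℂ} {a b : ℝ} {Δ : ℂ} {D : ℕ → ℂ}
    (hab : a ≤ b) (hF : ∀ n, ContinuousOn (F n) (Icc a b)) (hγ : ContinuousOn γ (Icc a b))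
    (hD : ∀ n, HasLogIncrement (F n) a b (D n)) (h : HasLogIncrement γ a b Δ)
    (hlim : TendstoUniformlyOn F γ atTop (Icc a b)) : Tendsto D atTop (𝓝 Δ) := by
  have h0 : ∀ t ∈ Icc a b, γ t ≠ 0 := by
    obtain ⟨L, -, hL, -⟩ := h
    exact fun t ht => by rw [← hL t ht]; exact Complex.exp_ne_zero _
  obtain ⟨t₀, ht₀, hmin⟩ := isCompact_Icc.exists_isMinOn (nonempty_Icc.2 hab) hγ.norm
  have hm : 0 < ‖γ t₀‖ := norm_pos_iff.2 (h0 t₀ ht₀)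
  have hlog : ∀ t ∈ Icc a b, Tendsto (fun n => Complex.log (F n t / γ t)) atTop (𝓝 0) := by
    intro t ht
    have := (hlim.tendsto_at ht).div_const (γ t)
    rw [div_self (h0 t ht)] at this
    simpa using this.clog Complex.one_mem_slitPlane
  have hlim2 := tendsto_const_nhds (x := Δ).add
    ((hlog b (right_mem_Icc.2 hab)).sub (hlog a (left_mem_Icc.2 hab)))
  rw [sub_zero, add_zero] at hlim2
  refine hlim2.congr' ?_
  filter_upwards [Metric.tendstoUniformlyOn_iff.1 hlim _ hm] with n hn
  refine (h.perturb hγ (hF n) fun t ht => ?_).unique hab (hD n)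
  rw [← dist_eq_norm, dist_comm]
  exact (hn t ht).trans_le (hmin ht)

/-- Arzelà–Ascoli for nonexpanding paths in a compact space. -/
theorem exists_subseq_tendstoUniformlyOn {X : Type*} [MetricSpace X] [CompactSpace X] {C : ℝ}
    (hC : 0 ≤ C) {f : ℕ → ℝ → X}
    (hf : ∀ n, ∀ s ∈ Icc 0 C, ∀ t ∈ Icc 0 C, dist (f n s) (f n t) ≤ |s - t|) :
    ∃ (F : ℝ → X) (k : ℕ → ℕ), ContinuousOn F (Icc 0 C) ∧ StrictMono k ∧
      TendstoUniformlyOn (fun n => f (k n)) F atTop (Icc 0 C) := by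
  have hcont : ∀ u : Icc 0 C → X, (∀ s t : Icc 0 C, dist (u s) (u t) ≤ |(s : ℝ) - t|) → Continuous u :=
    fun u hu => (LipschitzWith.of_dist_le_mul (K := 1) fun s t => by
      simpa [Subtype.dist_eq, Real.dist_eq] using hu s t).continuous
  set S : Set C(Icc 0 C, X) := {u | ∀ s t, dist (u s) (u t) ≤ |(s : ℝ) - t|} with hS
  have hScomp : IsCompact S := by
    refine ArzelaAscoli.isCompact_of_equicontinuous S ?_ ?_
    · have : ContinuousMap.toFun '' S = {u | ∀ s t : Icc 0 C, dist (u s) (u t) ≤ |(s : ℝ) - t|} := by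
        ext u
        exact ⟨by rintro ⟨u, hu, rfl⟩; exact hu, fun hu => ⟨⟨u, hcont u hu⟩, hu, rfl⟩⟩
      rw [this]
      refine IsClosed.isCompact ?_
      simp only [ofPred_forall]
      exact isClosed_iInter fun s => isClosed_iInter fun t =>
        isClosed_le (by fun_prop) continuous_const
    · refine (LipschitzWith.uniformEquicontinuous (K := 1) _ fun u =>
        LipschitzWith.of_dist_le_mul fun s t => ?_).equicontinuous
      simpa [Subtype.dist_eq, Real.dist_eq] using u.2 s t
  obtain ⟨u, -, k, hk, hlim⟩ := hScomp.tendsto_subseq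
    (x := fun n => ⟨fun t => f n t, hcont _ fun s t => hf n s s.2 t t.2⟩)
    (fun n s t => hf n s s.2 t t.2)
  refine ⟨fun t => u (projIcc 0 C hC t), k,
    (u.continuous.comp continuous_projIcc).continuousOn, hk, ?_⟩
  rw [ContinuousMap.tendsto_iff_tendstoUniformly] at hlim
  rw [Metric.tendstoUniformlyOn_iff]
  intro e he
  filter_upwards [Metric.tendstoUniformly_iff.1 hlim e he] with n hn t ht
  simpa [projIcc_of_mem hC ht] using hn ⟨t, ht⟩

namespace SlowJoined

variable {X : Type*} [MetricSpace X] {G : X → ℝ} {η : ℝ} {g : X → ℂ} {x y z : X} {T T' : ℝ}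
  {Δ Δ' : ℂ}

theorem left_lt (h : SlowJoined G η g x y T Δ) : G x < 2 := by
  obtain ⟨f, hT, -, hG, -, rfl, -⟩ := h
  exact hG 0 ⟨le_rfl, hT⟩

theorem exp_eq (h : SlowJoined G η g x y T Δ) : Complex.exp Δ = g y / g x := by
  obtain ⟨f, hT, -, -, hΔ, rfl, rfl⟩ := h
  exact hΔ.exp_eq hT

/-- A path in `{G < 1}` can be run at any slow speed. -/
theorem of_add_one (h : SlowJoined (fun p => G p + 1) 1 g x y T Δ) :
    SlowJoined G η g x y T Δ := by
  obtain ⟨f, hT, hf, hG, hΔ, hx, hy⟩ := h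
  refine ⟨f, hT, fun s t hs hst ht => ⟨(hf s t hs hst ht).1, fun H => ?_⟩,
    fun t ht => by linarith [hG t ht], hΔ, hx, hy⟩
  linarith [H s ⟨le_rfl, hst⟩, hG s ⟨hs, hst.trans ht⟩]

/-- Nearby points are joined by short slow paths. -/
theorem exists_of_dist_lt [CompactSpace X] (hX : IsLocallyGeodesicSpace X) (hG : Continuous G)
    (hg : Continuous g) (h0 : ∀ p, G p < 2 → g p ≠ 0) (hη : 0 < η) (hη1 : η ≤ 1) {K : Set X}
    (hK : IsCompact K) (hKG : ∀ p ∈ K, G p < 2) :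
    ∃ r > 0, ∀ y ∈ K, ∀ z, dist y z < r →
      SlowJoined G η g y z (dist y z / η) (Complex.log (g z / g y)) := by
  rcases K.eq_empty_or_nonempty with rfl | hKn
  · exact ⟨1, one_pos, by simp⟩
  obtain ⟨r₀, hr₀, hgeo⟩ := hX.exists_uniform
  obtain ⟨δ, hδ, hδK⟩ := hK.exists_thickening_subset_open (isOpen_lt hG continuous_const) hKG
  obtain ⟨p₀, hp₀, hmin⟩ := hK.exists_isMinOn hKn hg.norm.continuousOn
  obtain ⟨δ', hδ', hgu⟩ := Metric.uniformContinuous_iff.1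
    (CompactSpace.uniformContinuous_of_continuous hg) _ (norm_pos_iff.2 (h0 p₀ (hKG p₀ hp₀)))
  refine ⟨min r₀ (min δ δ'), by positivity, fun y hy z hyz => ?_⟩
  obtain ⟨c, rfl, hcz, hc⟩ := hgeo y z (hyz.trans_le (min_le_left _ _))
  have hyδ : dist (c 0) z < δ := hyz.trans_le ((min_le_right _ _).trans (min_le_left _ _))
  have hyδ' : dist (c 0) z < δ' := hyz.trans_le ((min_le_right _ _).trans (min_le_right _ _))
  set d := dist (c 0) z with hd
  have hd0 : 0 ≤ d := dist_nonneg
  have hcd : ∀ t ∈ Icc 0 d, dist (c 0) (c t) ≤ d := fun t ht => by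
    have := hc 0 ⟨le_rfl, hd0⟩ t ht
    rw [zero_sub, abs_neg, abs_of_nonneg ht.1] at this
    exact this.trans ht.2
  have hm : ∀ t ∈ Icc 0 (d / η), η * t ∈ Icc 0 d := fun t ht =>
    ⟨mul_nonneg hη.le ht.1, by rw [mul_comm]; exact (le_div_iff₀ hη).1 ht.2⟩
  have hslow : IsSlowPath G η (fun t => c (η * t)) 0 (d / η) :=
    IsSlowPath.of_dist_le hη1 fun s hs t ht => by
      have := hc _ (hm s hs) _ (hm t ht)
      rwa [← mul_sub, abs_mul, abs_of_pos hη] at this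
  have hy0 : g (c 0) ≠ 0 := h0 _ (hKG _ hy)
  have hlog : HasLogIncrement (fun t => g (c (η * t))) 0 (d / η)
      (Complex.log (g z / g (c 0))) := by
    have := (HasLogIncrement.const (a := 0) (b := d / η) hy0).mul_slitPlane
      (u := fun t => g (c (η * t)) / g (c 0))
      ((hg.comp_continuousOn hslow.continuousOn).div_const _) fun t ht => by
        apply Complex.ball_one_subset_slitPlane
        rw [mem_ball, dist_eq_norm, div_sub_one hy0, norm_div, ← dist_eq_norm,
          div_lt_one (norm_pos_iff.2 hy0), dist_comm]
        exact (hgu ((hcd _ (hm t ht)).trans_lt hyδ')).trans_le (hmin hy)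
    simp only [mul_zero, div_self hy0, Complex.log_one, sub_zero, zero_add,
      mul_div_cancel₀ _ hη.ne', hcz] at this
    exact this.congr fun t _ => (mul_div_cancel₀ _ hy0).symm
  refine ⟨_, by positivity, hslow, fun t ht => hδK (mem_thickening_iff.2
    ⟨c 0, hy, ?_⟩), hlog, by simp, by simp [mul_div_cancel₀ _ hη.ne', hcz]⟩
  rw [dist_comm]
  exact (hcd _ (hm t ht)).trans_lt hyδ

/-- A continuous path in `{G < 2}` can be replaced by a slow path with the same endpoints and the
same logarithmic increment. -/
theorem exists_of_continuousOn [CompactSpace X] (hX : IsLocallyGeodesicSpace X)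
    (hG : Continuous G) (hg : Continuous g) (h0 : ∀ p, G p < 2 → g p ≠ 0) {f : ℝ → X} {a b : ℝ}
    (hab : a ≤ b) (hf : ContinuousOn f (Icc a b)) (hfG : ∀ t ∈ Icc a b, G (f t) < 2)
    (hΔ : HasLogIncrement (fun t => g (f t)) a b Δ) :
    ∃ T, SlowJoined G 1 g (f a) (f b) T Δ := by
  obtain ⟨L, hL, hLe, rfl⟩ := hΔ
  replace hLe : ∀ t ∈ Icc a b, Complex.exp (L t) = g (f t) := hLe
  refine isPreconnected_Icc.induction₂ (fun s t => ∃ T, SlowJoined G 1 g (f s) (f t) T (L t - L s))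
    (fun s hs => ?_) (fun s t u hs ht hu ⟨T, hT⟩ ⟨T', hT'⟩ => ⟨T + T', ?_⟩)
    (fun s t hs ht ⟨T, hT⟩ => ⟨T, ?_⟩) (left_mem_Icc.2 hab) (right_mem_Icc.2 hab)
  · obtain ⟨r, hr, h⟩ := exists_of_dist_lt hX hG hg h0 one_pos le_rfl
      (isCompact_singleton (x := f s)) (by simpa using hfG s hs)
    filter_upwards [(hf s hs).eventually (ball_mem_nhds _ hr),
      (hL s hs).eventually (ball_mem_nhds _ Real.pi_pos), self_mem_nhdsWithin] with t h1 h2 ht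
    have := h _ rfl (f t) (mem_ball'.1 h1)
    rw [← hLe t ht, ← hLe s hs, ← Complex.exp_sub] at this
    have him := (Complex.abs_im_le_norm (L t - L s)).trans_lt (mem_ball_iff_norm.1 h2)
    rw [Complex.log_exp (abs_lt.1 him).1 (abs_lt.1 him).2.le] at this
    exact ⟨_, this⟩
  · simpa using hT.trans hT'
  · simpa using hT.symm

/-- Existence of shortest slow paths under a closed condition on the endpoints and the
logarithmic increment. -/
theorem exists_minimal [CompactSpace X] (hG : Continuous G)
    (hg : Continuous g) (h0 : ∀ p, G p < 2 → g p ≠ 0) (hη : 0 ≤ η) {E : X → X → ℂ → Prop}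
    (hE : IsClosed {p : X × X × ℂ | E p.1 p.2.1 p.2.2}) {C s ℓ : ℝ}
    (hs : η * C < s) (hℓ : η * C < ℓ) (hsep : ∀ p q, G p ≤ 1 → 2 ≤ G q → s ≤ dist p q)
    (hlong : ∀ (f : ℝ → X) (T : ℝ) (Δ : ℂ), 0 ≤ T → ContinuousOn f (Icc 0 T) →
      (∀ t ∈ Icc 0 T, G (f t) < 2) → HasLogIncrement (fun t => g (f t)) 0 T Δ →
      E (f 0) (f T) Δ → ∃ t ∈ Icc 0 T, ℓ ≤ dist (f 0) (f t))
    (hex : ∃ x y Δ, E x y Δ ∧ SlowJoined G η g x y C Δ) :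
    ∃ x y T Δ, E x y Δ ∧ SlowJoined G η g x y T Δ ∧
      ∀ x' y' T' Δ', E x' y' Δ' → SlowJoined G η g x' y' T' Δ' → T ≤ T' := by
  set A : Set ℝ := {T | ∃ x y Δ, E x y Δ ∧ SlowJoined G η g x y T Δ} with hA
  have hA0 : ∀ T ∈ A, 0 ≤ T := by
    rintro T ⟨x, y, Δ, -, f, hT, -⟩
    exact hT
  have hAb : BddBelow A := ⟨0, hA0⟩
  have hAn : A.Nonempty := ⟨C, hex⟩
  have hC : 0 ≤ C := hA0 C hex
  suffices hmem : sInf A ∈ A by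
    obtain ⟨x, y, Δ, h1, h2⟩ := hmem
    exact ⟨x, y, _, Δ, h1, h2, fun x' y' T' Δ' h1' h2' => csInf_le hAb ⟨x', y', Δ', h1', h2'⟩⟩
  obtain ⟨u, -, hulim, huA⟩ := exists_seq_tendsto_sInf hAn hAb
  set m := sInf A with hm
  have hm0 : 0 ≤ m := le_csInf hAn hA0
  have hmC : m ≤ C := csInf_le hAb hex
  set v : ℕ → ℝ := fun n => min (u n) C with hv
  have hvA : ∀ n, v n ∈ A := fun n => by
    rcases min_choice (u n) C with h | h <;> simp only [hv, h]
    exacts [huA n, hex]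
  have hvm : ∀ n, m ≤ v n := fun n => csInf_le hAb (hvA n)
  have hvC : ∀ n, v n ≤ C := fun n => min_le_right _ _
  have hvlim : Tendsto v atTop (𝓝 m) := by
    simpa [hmC] using hulim.min (tendsto_const_nhds (x := C))
  have hseq : ∀ n, ∃ (f : ℝ → X) (Δ : ℂ), IsSlowPath G η f 0 C ∧
      HasLogIncrement (fun t => g (f t)) 0 C Δ ∧ E (f 0) (f C) Δ ∧
      (∃ t ∈ Icc 0 C, ℓ ≤ dist (f 0) (f t)) ∧ ∀ t ∈ Icc m C, dist (f t) (f C) ≤ v n - m := by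
    intro n
    obtain ⟨x, y, Δ, hEn, f, hT, hf, hfG, hfΔ, rfl, rfl⟩ := hvA n
    set F : ℝ → X := fun t => f (min t (v n)) with hF
    have e1 : EqOn F f (Icc 0 (v n)) := fun t ht => by simp [hF, ht.2]
    have e2 : EqOn F (fun _ => f (v n)) (Icc (v n) C) := fun t ht => by simp [hF, ht.1]
    have h2 := h0 _ (hfG (v n) ⟨hT, le_rfl⟩)
    have hFC : F C = f (v n) := e2 ⟨hvC n, le_rfl⟩
    have hF0 : F 0 = f 0 := e1 ⟨le_rfl, hT⟩
    refine ⟨F, Δ, (hf.congr e1).trans (IsSlowPath.congr (fun s t _ hst _ => ?_) e2),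
      ?_, by rwa [hFC, hF0], ?_, fun t ht => ?_⟩
    · rw [dist_self]
      exact ⟨sub_nonneg.2 hst, fun _ => mul_nonneg hη (sub_nonneg.2 hst)⟩
    · rw [← add_zero Δ]
      exact (hfΔ.congr fun t ht => by simp only [e1 ht]).trans hT (hvC n)
        ((HasLogIncrement.const h2).congr fun t ht => by simp only [e2 ht])
    · obtain ⟨t, ht, h⟩ := hlong f (v n) Δ hT hf.continuousOn hfG hfΔ hEn
      exact ⟨t, ⟨ht.1, ht.2.trans (hvC n)⟩, by rwa [hF0, e1 ht]⟩
    · rw [hFC]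
      have hmin : m ≤ min t (v n) := le_min ht.1 (hvm n)
      have := hf.dist_le (s := min t (v n)) (t := v n) ⟨hm0.trans hmin, min_le_right _ _⟩
        ⟨hT, le_rfl⟩
      rw [abs_of_nonpos (by linarith [min_le_right t (v n)])] at this
      exact this.trans (by linarith)
  choose f D hf hfΔ hEf hfl hfm using hseq
  obtain ⟨F, k, hF, hk, hlim⟩ := exists_subseq_tendstoUniformlyOn hC
    fun n s hs t ht => (hf n).dist_le hs ht
  have hC0 : (0 : ℝ) ∈ Icc 0 C := ⟨le_rfl, hC⟩
  have hCC : C ∈ Icc 0 C := ⟨hC, le_rfl⟩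
  have hFs : IsSlowPath G η F 0 C :=
    IsSlowPath.of_tendstoUniformlyOn (fun n => hf (k n)) hG hF hlim
  have hFl : ∃ t ∈ Icc 0 C, ℓ ≤ dist (F 0) (F t) := by
    obtain ⟨t, ht, hmax⟩ := isCompact_Icc.exists_isMaxOn ⟨0, hC0⟩
      ((continuous_const.dist continuous_id).comp_continuousOn hF :
        ContinuousOn (fun t => dist (F 0) (F t)) (Icc 0 C))
    refine ⟨t, ht, le_of_forall_pos_le_add fun e he => ?_⟩
    obtain ⟨n, hn⟩ := (Metric.tendstoUniformlyOn_iff.1 hlim (e / 2) (half_pos he)).exists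
    obtain ⟨t', ht', h'⟩ := hfl (k n)
    have h1 := hn 0 hC0
    have h2 := hn t' ht'
    have h3 : dist (F 0) (F t') ≤ dist (F 0) (F t) := hmax ht'
    have h4 := dist_triangle4 (f (k n) 0) (F 0) (F t') (f (k n) t')
    rw [dist_comm (f (k n) 0) (F 0)] at h4
    linarith
  have hFG := hFs.lt_two hG hη le_rfl hs hℓ hsep hFl
  have hgF : ContinuousOn (fun t => g (F t)) (Icc 0 C) := hg.comp_continuousOn hF
  have hFm : ∀ t ∈ Icc m C, F t = F C := by
    intro t ht
    refine dist_le_zero.1 (le_of_tendsto_of_tendsto' ((hlim.tendsto_at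
      ⟨hm0.trans ht.1, ht.2⟩).dist (hlim.tendsto_at hCC)) ?_ fun n => hfm (k n) t ht)
    simpa using (hvlim.comp hk.tendsto_atTop).sub_const m
  obtain ⟨Δ, hΔ⟩ := HasLogIncrement.exists_of_ne_zero hm0
    (hgF.mono (Icc_subset_Icc_right hmC)) fun t ht => h0 _ (hFG t ⟨ht.1, ht.2.trans hmC⟩)
  have hΔC : HasLogIncrement (fun t => g (F t)) 0 C Δ := by
    rw [← add_zero Δ]
    exact hΔ.trans hm0 hmC ((HasLogIncrement.const (h0 _ (hFG C hCC))).congr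
      fun t ht => by simp only [hFm t ht])
  have hDlim : Tendsto (fun n => D (k n)) atTop (𝓝 Δ) :=
    HasLogIncrement.tendsto hC (fun n => hg.comp_continuousOn (hf (k n)).continuousOn) hgF
      (fun n => hfΔ (k n)) hΔC
      ((CompactSpace.uniformContinuous_of_continuous hg).comp_tendstoUniformlyOn hlim)
  refine ⟨F 0, F C, Δ, hE.mem_of_tendsto ((hlim.tendsto_at hC0).prodMk_nhds
    ((hlim.tendsto_at hCC).prodMk_nhds hDlim)) (Eventually.of_forall fun n => hEf (k n)),
    F, hm0, hFs.mono le_rfl hmC, fun t ht => hFG t ⟨ht.1, ht.2.trans hmC⟩, hΔ, rfl,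
    hFm m ⟨le_rfl, hmC⟩⟩

end SlowJoined

theorem one_le_norm_of_exp_eq_one {z : ℂ} (h : Complex.exp z = 1) (h0 : z ≠ 0) : 1 ≤ ‖z‖ := by
  obtain ⟨n, rfl⟩ := Complex.exp_eq_one_iff.1 h
  have hn : (n : ℤ) ≠ 0 := by
    rintro rfl
    simp at h0
  have h1 : (1 : ℝ) ≤ |(n : ℝ)| := by exact_mod_cast Int.one_le_abs hn
  have h2 := Real.pi_gt_three
  simp only [norm_mul, Complex.norm_intCast, Complex.norm_ofNat, Complex.norm_real, Complex.norm_I,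
    Real.norm_of_nonneg Real.pi_pos.le]
  nlinarith

/-- Two closed disjoint sets in a compact space have positive distance. -/
theorem exists_pos_le_dist {X : Type*} [MetricSpace X] [CompactSpace X] {A B : Set X}
    (hA : IsClosed A) (hB : IsClosed B) (hAB : Disjoint A B) :
    ∃ δ > 0, ∀ p ∈ A, ∀ q ∈ B, δ ≤ dist p q := by
  obtain ⟨δ, hδ, h⟩ := hA.isCompact.exists_thickening_subset_open hB.isOpen_compl
    (disjoint_left.1 hAB)
  refine ⟨δ, hδ, fun p hp q hq => ?_⟩
  by_contra! hlt
  exact h (mem_thickening_iff.2 ⟨p, hp, by rwa [dist_comm]⟩) hq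

section

variable {X : Type*} [MetricSpace X] [CompactSpace X] {G : X → ℝ} {g : X → ℂ}

/-- A continuous path in `{G < 1}` can be replaced by a slow path of controlled duration. -/
theorem exists_slowJoined (hX : IsLocallyGeodesicSpace X) (hG : Continuous G)
    (hg : Continuous g) (h0 : ∀ p, G p < 2 → g p ≠ 0) {f : ℝ → X} {a b : ℝ} {Δ : ℂ}
    (hab : a ≤ b) (hf : ContinuousOn f (Icc a b)) (hfG : ∀ t ∈ Icc a b, G (f t) < 1)
    (hΔ : HasLogIncrement (fun t => g (f t)) a b Δ) {ℓ : ℝ} (hℓ : 0 < ℓ) :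
    ∃ η C s, 0 < η ∧ η ≤ 1 ∧ η * C < s ∧ η * C < ℓ ∧
      (∀ p q, G p ≤ 1 → 2 ≤ G q → s ≤ dist p q) ∧ SlowJoined G η g (f a) (f b) C Δ := by
  obtain ⟨s, hs, hsep⟩ := exists_pos_le_dist (isClosed_le hG continuous_const)
    (isClosed_le continuous_const hG) (disjoint_left.2 fun p (h1 : G p ≤ 1) (h2 : 2 ≤ G p) => by
      linarith)
  obtain ⟨C, hC⟩ := SlowJoined.exists_of_continuousOn hX (G := fun p => G p + 1) (by fun_prop) hg
    (fun p hp => h0 p (by linarith)) hab hf (fun t ht => by linarith [hfG t ht]) hΔ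
  have hC0 : 0 ≤ C := by
    obtain ⟨-, h, -⟩ := hC
    exact h
  have hm : 0 < min s ℓ := lt_min hs hℓ
  have hη : min s ℓ / (C + min s ℓ) * C < min s ℓ := by
    rw [div_mul_eq_mul_div, div_lt_iff₀ (by positivity)]
    nlinarith
  exact ⟨min s ℓ / (C + min s ℓ), C, s, by positivity, (div_le_one (by positivity)).2 (by linarith),
    hη.trans_le (min_le_left _ _), hη.trans_le (min_le_right _ _),
    fun p q hp hq => hsep p hp q hq, hC.of_add_one⟩

/-- A shortest slow path between two closed sets is a biLipschitz arc which meets the two sets only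
at its endpoints. -/
theorem exists_biLipschitz_arc (hX : IsLocallyGeodesicSpace X) (hG : Continuous G) {A B : Set X}
    (hA : IsClosed A) (hB : IsClosed B) (hAB : ∀ p ∈ A, p ∈ B → 2 < G p) {f₀ : ℝ → X} {a b : ℝ}
    (hab : a ≤ b) (hf₀ : ContinuousOn f₀ (Icc a b)) (hfG : ∀ t ∈ Icc a b, G (f₀ t) < 1)
    (hfA : f₀ a ∈ A) (hfB : f₀ b ∈ B) :
    ∃ f : ℝ → X, BiLipschitzOn f (Icc 0 1) ∧ f 0 ∈ A ∧ f 1 ∈ B ∧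
      (∀ t ∈ Ioo (0 : ℝ) 1, f t ∉ A ∪ B) ∧ ∀ t ∈ Icc (0 : ℝ) 1, G (f t) < 2 := by
  have hcl := isClosed_le hG (continuous_const (y := (2 : ℝ)))
  obtain ⟨ℓ, hℓ, hℓAB⟩ := exists_pos_le_dist (hA.inter hcl) (hB.inter hcl)
    (disjoint_left.2 fun p (h1 : p ∈ A ∧ G p ≤ 2) (h2 : p ∈ B ∧ G p ≤ 2) =>
      (hAB p h1.1 h2.1).not_ge h1.2)
  obtain ⟨η, C, s₀, hη, hη1, hs, hηℓ, hsep, hC⟩ := exists_slowJoined hX hG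
    (g := fun _ => 1) continuous_const (fun _ _ => one_ne_zero) hab hf₀ hfG
    (.const one_ne_zero) hℓ
  obtain ⟨x, y, T, Δ, ⟨hxA, hyB⟩, ⟨f, hT, hf, hfG, hfΔ, rfl, rfl⟩, hmin⟩ :=
    SlowJoined.exists_minimal hG continuous_const (fun _ _ => one_ne_zero) hη.le
      (E := fun x y _ => x ∈ A ∧ y ∈ B)
      ((hA.preimage continuous_fst).inter (hB.preimage (by fun_prop : Continuous
        fun p : X × X × ℂ => p.2.1))) hs hηℓ hsep
      (fun f T Δ hT _ hfG _ hE => ⟨T, ⟨hT, le_rfl⟩, hℓAB _ ⟨hE.1, (hfG 0 ⟨le_rfl, hT⟩).le⟩ _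
        ⟨hE.2, (hfG T ⟨hT, le_rfl⟩).le⟩⟩)
      ⟨_, _, _, ⟨hfA, hfB⟩, hC⟩
  have hsub : ∀ s t, 0 ≤ s → s ≤ t → t ≤ T →
      SlowJoined G η (fun _ => 1) (f s) (f t) (t - s) 0 := fun s t h0s hst htT =>
    SlowJoined.of_isSlowPath hst (hf.mono h0s htT)
      (fun u hu => hfG u ⟨h0s.trans hu.1, hu.2.trans htT⟩) (.const one_ne_zero)
  have hT0 : 0 < T := by
    refine hT.lt_of_ne ?_
    rintro rfl
    have := hℓAB _ ⟨hxA, (hfG 0 ⟨le_rfl, le_rfl⟩).le⟩ _ ⟨hyB, (hfG 0 ⟨le_rfl, le_rfl⟩).le⟩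
    rw [dist_self] at this
    linarith
  obtain ⟨r, hr, hshort⟩ := SlowJoined.exists_of_dist_lt hX hG (g := fun _ => 1) continuous_const
    (fun _ _ => one_ne_zero) hη hη1 (isCompact_Icc.image_of_continuousOn hf.continuousOn)
    (forall_mem_image.2 hfG)
  have hlow : ∀ s t, 0 ≤ s → s ≤ t → t ≤ T →
      t - s ≤ (1 / η + T / r) * dist (f s) (f t) := by
    intro s t h0s hst htT
    rcases lt_or_ge (dist (f s) (f t)) r with hd | hd
    · have := hmin _ _ _ _ ⟨hxA, hyB⟩ (((hsub 0 s le_rfl h0s (hst.trans htT)).trans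
        (hshort _ (mem_image_of_mem f ⟨h0s, hst.trans htT⟩) _ hd)).trans
        (hsub t T (h0s.trans hst) htT le_rfl))
      have h2 : 0 ≤ T / r * dist (f s) (f t) := by positivity
      rw [div_eq_inv_mul, ← one_div] at this
      linarith
    · have h1 : T ≤ T / r * dist (f s) (f t) := by
        rw [div_mul_eq_mul_div, le_div_iff₀ hr]
        gcongr
      have h2 : 0 ≤ 1 / η * dist (f s) (f t) := by positivity
      linarith
  have hlow' : ∀ s ∈ Icc 0 T, ∀ t ∈ Icc 0 T,
      |s - t| ≤ (1 / η + T / r) * dist (f s) (f t) := by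
    intro s hs t ht
    rcases le_total s t with h | h
    · rw [abs_sub_comm, abs_of_nonneg (sub_nonneg.2 h)]
      exact hlow s t hs.1 h ht.2
    · rw [abs_of_nonneg (sub_nonneg.2 h), dist_comm]
      exact hlow t s ht.1 h hs.2
  have hm : ∀ t ∈ Icc (0 : ℝ) 1, T * t ∈ Icc 0 T := fun t ht =>
    ⟨mul_nonneg hT ht.1, mul_le_of_le_one_right hT ht.2⟩
  refine ⟨fun t => f (T * t), ?_, by simpa using hxA, by simpa using hyB, ?_,
    fun t ht => hfG _ (hm t ht)⟩
  · have hM : 0 < T + (1 / η + T / r) / T := by positivity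
    refine ⟨Real.toNNReal (T + (1 / η + T / r) / T), Real.toNNReal_pos.2 hM,
      fun s hs t ht => ?_⟩
    have h1 := hf.dist_le (hm s hs) (hm t ht)
    have h2 := hlow' _ (hm s hs) _ (hm t ht)
    rw [← mul_sub, abs_mul, abs_of_pos hT0] at h1 h2
    rw [Real.dist_eq, Real.coe_toNNReal _ hM.le]
    constructor
    · rw [inv_mul_le_iff₀ hM]
      have h3 : |s - t| ≤ (1 / η + T / r) / T * dist (f (T * s)) (f (T * t)) := by
        rw [div_mul_eq_mul_div, le_div_iff₀ hT0]
        linarith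
      have h4 : 0 ≤ T * dist (f (T * s)) (f (T * t)) := by positivity
      rw [add_mul]
      linarith
    · refine h1.trans ?_
      gcongr
      have : 0 ≤ (1 / η + T / r) / T := by positivity
      linarith
  · rintro t ⟨ht0, ht1⟩ (h | h)
    · have := hmin _ _ _ _ ⟨h, hyB⟩ (hsub (T * t) T (by positivity) (by nlinarith) le_rfl)
      nlinarith
    · have := hmin _ _ _ _ ⟨hxA, h⟩ (hsub 0 (T * t) le_rfl (by positivity) (by nlinarith))
      nlinarith

/-- A shortest slow loop with nonzero logarithmic increment is a biLipschitz loop. -/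
theorem exists_biLipschitz_loop (hX : IsLocallyGeodesicSpace X) (hG : Continuous G)
    (hg : Continuous g) (h0 : ∀ p, G p ≤ 2 → g p ≠ 0) {f₀ : ℝ → X} {a b : ℝ} {Δ₀ : ℂ}
    (hab : a ≤ b) (hf₀ : ContinuousOn f₀ (Icc a b)) (hfG : ∀ t ∈ Icc a b, G (f₀ t) < 1)
    (hfab : f₀ a = f₀ b) (hΔ₀ : HasLogIncrement (fun t => g (f₀ t)) a b Δ₀) (hΔ₀0 : Δ₀ ≠ 0) :
    ∃ (f : ℝ → X) (T K : ℝ) (Δ : ℂ), 0 < T ∧ 0 < K ∧ f 0 = f T ∧ Δ ≠ 0 ∧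
      HasLogIncrement (fun t => g (f t)) 0 T Δ ∧ (∀ t ∈ Icc 0 T, G (f t) < 2) ∧
      (∀ s ∈ Icc 0 T, ∀ t ∈ Icc 0 T, dist (f s) (f t) ≤ |s - t|) ∧
      ∀ s ∈ Icc 0 T, ∀ t ∈ Icc 0 T, min |s - t| (T - |s - t|) ≤ K * dist (f s) (f t) := by
  have h0' : ∀ p, G p < 2 → g p ≠ 0 := fun p hp => h0 p hp.le
  obtain ⟨p₀, hp₀, hpmin⟩ := (isClosed_le hG (continuous_const (y := (2 : ℝ)))
    ).isCompact.exists_isMinOn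
    ⟨f₀ a, (hfG a (left_mem_Icc.2 hab)).le.trans one_le_two⟩ hg.norm.continuousOn
  obtain ⟨ℓ, hℓ, hgu⟩ := Metric.uniformContinuous_iff.1
    (CompactSpace.uniformContinuous_of_continuous hg) _ (norm_pos_iff.2 (h0 p₀ hp₀))
  obtain ⟨η, C, s₀, hη, hη1, hs, hηℓ, hsep, hC⟩ := exists_slowJoined hX hG hg h0' hab hf₀ hfG
    hΔ₀ hℓ
  have hone : ∀ {x T Δ}, SlowJoined G η g x x T Δ → Δ ≠ 0 → 1 ≤ ‖Δ‖ := fun h =>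
    one_le_norm_of_exp_eq_one (by rw [h.exp_eq, div_self (h0' _ h.left_lt)])
  have hlong : ∀ (f : ℝ → X) (T : ℝ) (Δ : ℂ), 0 ≤ T → ContinuousOn f (Icc 0 T) →
      (∀ t ∈ Icc 0 T, G (f t) < 2) → HasLogIncrement (fun t => g (f t)) 0 T Δ →
      f 0 = f T ∧ 1 ≤ ‖Δ‖ → ∃ t ∈ Icc 0 T, ℓ ≤ dist (f 0) (f t) := by
    rintro f T Δ hT hf hfG hΔ ⟨hcl, hΔ1⟩
    by_contra! hcon
    have hf0 : g (f 0) ≠ 0 := h0' _ (hfG 0 ⟨le_rfl, hT⟩)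
    have := (HasLogIncrement.const (a := 0) (b := T) hf0).perturb continuousOn_const
      (hg.comp_continuousOn hf) fun t ht => by
        rw [← dist_eq_norm, dist_comm]
        exact (hgu (hcon t ht)).trans_le (hpmin (hfG 0 ⟨le_rfl, hT⟩).le)
    have hΔ' := hΔ.unique hT this
    simp only [Function.comp_apply, ← hcl, sub_self, add_zero] at hΔ'
    rw [hΔ', norm_zero] at hΔ1
    linarith
  obtain ⟨x, y, T, Δ, ⟨hxy, hΔ1⟩, ⟨f, hT, hf, hfG, hfΔ, rfl, rfl⟩, hmin⟩ :=
    SlowJoined.exists_minimal hG hg h0' hη.le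
      (E := fun x y Δ => x = y ∧ 1 ≤ ‖Δ‖)
      ((isClosed_eq continuous_fst (continuous_fst.comp continuous_snd)).inter
        (isClosed_le continuous_const (continuous_snd.comp continuous_snd).norm)) hs hηℓ hsep hlong
      ⟨_, _, _, ⟨hfab, by rw [← hfab] at hC; exact hone hC hΔ₀0⟩, hC⟩
  have hsub : ∀ s t, 0 ≤ s → s ≤ t → t ≤ T → ∀ D, HasLogIncrement (fun t => g (f t)) s t D →
      SlowJoined G η g (f s) (f t) (t - s) D := fun s t h0s hst htT D hD =>
    SlowJoined.of_isSlowPath hst (hf.mono h0s htT)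
      (fun u hu => hfG u ⟨h0s.trans hu.1, hu.2.trans htT⟩) hD
  have hsubΔ : ∀ s t, 0 ≤ s → s ≤ t → t ≤ T →
      ∃ D, HasLogIncrement (fun t => g (f t)) s t D := fun s t h0s hst htT =>
    HasLogIncrement.exists_of_ne_zero hst
      (hg.comp_continuousOn (hf.continuousOn.mono (Icc_subset_Icc h0s htT)))
      fun u hu => h0' _ (hfG u ⟨h0s.trans hu.1, hu.2.trans htT⟩)
  have hT0 : 0 < T := by
    obtain ⟨t, ht, h⟩ := hlong f T Δ hT hf.continuousOn hfG hfΔ ⟨hxy, hΔ1⟩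
    have := hf.dist_le ⟨le_rfl, hT⟩ ht
    rw [zero_sub, abs_neg, abs_of_nonneg ht.1] at this
    linarith [ht.2]
  obtain ⟨r, hr, hshort⟩ := SlowJoined.exists_of_dist_lt hX hG hg h0' hη hη1
    (isCompact_Icc.image_of_continuousOn hf.continuousOn) (forall_mem_image.2 hfG)
  have hlow : ∀ s t, 0 ≤ s → s ≤ t → t ≤ T →
      min (t - s) (T - (t - s)) ≤ (1 / η + T / r) * dist (f s) (f t) := by
    intro s t h0s hst htT
    rcases lt_or_ge (dist (f s) (f t)) r with hd | hd
    · have hS := hshort _ (mem_image_of_mem f ⟨h0s, hst.trans htT⟩) _ hd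
      set W := Complex.log (g (f t) / g (f s))
      obtain ⟨D₁, hD₁⟩ := hsubΔ 0 s le_rfl h0s (hst.trans htT)
      obtain ⟨D₂, hD₂⟩ := hsubΔ s t h0s hst htT
      obtain ⟨D₃, hD₃⟩ := hsubΔ t T (h0s.trans hst) htT le_rfl
      have hsum : D₁ + D₂ + D₃ = Δ :=
        ((hD₁.trans h0s hst hD₂).trans (h0s.trans hst) htT hD₃).unique hT hfΔ
      have hloop₁ := ((hsub 0 s le_rfl h0s (hst.trans htT) _ hD₁).trans hS).trans
        (hsub t T (h0s.trans hst) htT le_rfl _ hD₃)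
      have hloop₂ := (hsub s t h0s hst htT _ hD₂).trans hS.symm
      have h2 : 0 ≤ T / r * dist (f s) (f t) := by positivity
      have h3 : dist (f s) (f t) / η = 1 / η * dist (f s) (f t) := by ring
      rw [h3] at hloop₁ hloop₂
      by_cases hz : D₂ - W = 0
      · have hz' : D₁ + W + D₃ = Δ := by linear_combination hsum - hz
        rw [hz'] at hloop₁
        have := hmin _ _ _ _ ⟨hxy, hΔ1⟩ hloop₁
        exact (min_le_left _ _).trans (by linarith)
      · have := hmin _ _ _ _ ⟨rfl, hone hloop₂ (by rwa [← sub_eq_add_neg])⟩ hloop₂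
        exact (min_le_right _ _).trans (by linarith)
    · have h1 : T ≤ T / r * dist (f s) (f t) := by
        rw [div_mul_eq_mul_div, le_div_iff₀ hr]
        gcongr
      have h2 : 0 ≤ 1 / η * dist (f s) (f t) := by positivity
      exact (min_le_left _ _).trans (by linarith)
  refine ⟨f, T, 1 / η + T / r, Δ, hT0, by positivity, hxy, fun h => ?_, hfΔ, hfG,
    fun s hs t ht => hf.dist_le hs ht, fun s hs t ht => ?_⟩
  · rw [h, norm_zero] at hΔ1
    linarith
  · rcases le_total s t with h | h
    · rw [abs_sub_comm, abs_of_nonneg (sub_nonneg.2 h)]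
      exact hlow s t hs.1 h ht.2
    · rw [abs_of_nonneg (sub_nonneg.2 h), dist_comm]
      exact hlow t s ht.1 h hs.2

end

/-- The chordal distance of two points of the unit circle is comparable to their angular
distance. -/
theorem norm_exp_sub_exp_bounds {s t : ℝ} (hs : s ∈ Icc 0 (2 * Real.pi))
    (ht : t ∈ Icc 0 (2 * Real.pi)) :
    2 / Real.pi * min |s - t| (2 * Real.pi - |s - t|) ≤
        ‖Complex.exp (s * Complex.I) - Complex.exp (t * Complex.I)‖ ∧
      ‖Complex.exp (s * Complex.I) - Complex.exp (t * Complex.I)‖ ≤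
        min |s - t| (2 * Real.pi - |s - t|) := by
  have hπ := Real.pi_pos
  have hd : |s - t| ≤ 2 * Real.pi := abs_le.2 ⟨by linarith [hs.1, ht.2], by linarith [hs.2, ht.1]⟩
  have hnorm : ‖Complex.exp (s * Complex.I) - Complex.exp (t * Complex.I)‖ =
      2 * Real.sin (|s - t| / 2) := by
    have h1 : Complex.exp (s * Complex.I) - Complex.exp (t * Complex.I) =
        Complex.exp (t * Complex.I) * (Complex.exp (Complex.I * (s - t : ℝ)) - 1) := by
      rw [mul_sub, ← Complex.exp_add, mul_one]
      push_cast
      ring_nf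
    rw [h1, norm_mul, Complex.norm_exp_ofReal_mul_I, one_mul,
      Complex.norm_exp_I_mul_ofReal_sub_one, Real.norm_eq_abs, abs_mul, abs_two]
    congr 1
    rw [Real.abs_sin_eq_sin_abs_of_abs_le_pi (x := (s - t) / 2)
      (by rw [abs_div, abs_two]; linarith), abs_div, abs_two]
  rw [hnorm]
  have hd0 := abs_nonneg (s - t)
  generalize |s - t| = d at hd hd0
  have hbd : ∀ m, 0 ≤ m → m ≤ Real.pi → 2 / Real.pi * m ≤ 2 * Real.sin (m / 2) ∧
      2 * Real.sin (m / 2) ≤ m := fun m h0 h1 => by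
    have := Real.mul_le_sin (x := m / 2) (by linarith) (by linarith)
    have := Real.sin_le (x := m / 2) (by linarith)
    constructor <;> linarith
  rcases le_total d Real.pi with h | h
  · rw [min_eq_left (by linarith)]
    exact hbd d hd0 h
  · rw [min_eq_right (by linarith), ← Real.sin_pi_sub,
      show Real.pi - d / 2 = (2 * Real.pi - d) / 2 by ring]
    exact hbd _ (by linarith) (by linarith)

/-- A biLipschitz loop parametrized by an interval can be reparametrized by the unit circle. -/
theorem exists_biLipschitzOn_unitCircle {X : Type*} [MetricSpace X] {f : ℝ → X} {T K : ℝ}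
    (hT : 0 < T) (hK : 0 < K) (hclosed : f 0 = f T)
    (hL : ∀ s ∈ Icc 0 T, ∀ t ∈ Icc 0 T, dist (f s) (f t) ≤ |s - t|)
    (hmin : ∀ s ∈ Icc 0 T, ∀ t ∈ Icc 0 T, min |s - t| (T - |s - t|) ≤ K * dist (f s) (f t)) :
    ∃ F : E2 → X, BiLipschitzOn F unitCircle ∧ F '' unitCircle = f '' Icc 0 T := by
  have hπ := Real.pi_pos
  have hL' : ∀ s ∈ Icc 0 T, ∀ t ∈ Icc 0 T, dist (f s) (f t) ≤ min |s - t| (T - |s - t|) := by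
    have key : ∀ s t, 0 ≤ s → s ≤ t → t ≤ T → dist (f s) (f t) ≤ T - (t - s) := by
      intro s t hs hst ht
      have h1 := hL s ⟨hs, hst.trans ht⟩ 0 ⟨le_rfl, hT.le⟩
      have h2 := hL T ⟨hT.le, le_rfl⟩ t ⟨hs.trans hst, ht⟩
      rw [sub_zero, abs_of_nonneg hs, hclosed] at h1
      rw [abs_of_nonneg (sub_nonneg.2 ht)] at h2
      linarith [dist_triangle (f s) (f T) (f t)]
    refine fun s hs t ht => le_min (hL s hs t ht) ?_
    rcases le_total s t with h | h
    · rw [abs_sub_comm, abs_of_nonneg (sub_nonneg.2 h)]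
      exact key s t hs.1 h ht.2
    · rw [abs_of_nonneg (sub_nonneg.2 h), dist_comm]
      exact key t s ht.1 h hs.2
  set e : E2 ≃ₗᵢ[ℝ] ℂ := Complex.orthonormalBasisOneI.repr.symm
  set c := T / (2 * Real.pi) with hc
  have hc0 : 0 < c := by positivity
  have hcT : c * (2 * Real.pi) = T := by rw [hc]; field_simp
  have hmem : ∀ θ ∈ Icc 0 (2 * Real.pi), c * θ ∈ Icc 0 T := fun θ hθ =>
    ⟨mul_nonneg hc0.le hθ.1, hcT ▸ mul_le_mul_of_nonneg_left hθ.2 hc0.le⟩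
  have hscale : ∀ s t : ℝ, min |c * s - c * t| (T - |c * s - c * t|) =
      c * min |s - t| (2 * Real.pi - |s - t|) := fun s t => by
    rw [← mul_sub, abs_mul, abs_of_pos hc0, mul_min_of_nonneg _ _ hc0.le, mul_sub, hcT]
  set θ : E2 → ℝ := fun z => toIcoMod Real.two_pi_pos 0 (Complex.arg (e z)) with hθ
  have hθm : ∀ z, θ z ∈ Icc 0 (2 * Real.pi) := fun z => by
    have := toIcoMod_mem_Ico Real.two_pi_pos 0 (Complex.arg (e z))
    rw [zero_add] at this
    exact Ico_subset_Icc_self this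
  have hθe : ∀ z ∈ unitCircle, Complex.exp (θ z * Complex.I) = e z := fun z hz => by
    have h1 : ‖e z‖ = 1 := by rw [e.norm_map]; exact mem_sphere_zero_iff_norm.1 hz
    conv_rhs => rw [← Complex.norm_mul_exp_arg_mul_I (e z), h1, Complex.ofReal_one, one_mul]
    rw [Complex.exp_eq_exp_iff_exists_int]
    refine ⟨-toIcoDiv Real.two_pi_pos 0 (Complex.arg (e z)), ?_⟩
    simp only [hθ, toIcoMod]
    push_cast [zsmul_eq_mul]
    ring
  have hdist : ∀ z ∈ unitCircle, ∀ s ∈ Icc 0 (2 * Real.pi),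
      dist (f (c * θ z)) (f (c * s)) ≤
        c * (Real.pi / 2) * dist (e z) (Complex.exp (s * Complex.I)) ∧
      dist (e z) (Complex.exp (s * Complex.I)) ≤ K / c * dist (f (c * θ z)) (f (c * s)) := by
    intro z hz s hs
    rw [← hθe z hz, dist_eq_norm]
    obtain ⟨h1, h2⟩ := norm_exp_sub_exp_bounds (hθm z) hs
    have h3 := hL' _ (hmem _ (hθm z)) _ (hmem _ hs)
    have h4 := hmin _ (hmem _ (hθm z)) _ (hmem _ hs)
    rw [hscale] at h3 h4
    constructor
    · refine h3.trans ?_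
      rw [mul_assoc]
      gcongr
      rw [div_mul_eq_mul_div, div_le_iff₀ hπ] at h1
      linarith
    · refine h2.trans ?_
      rw [div_mul_eq_mul_div, le_div_iff₀ hc0]
      linarith
  have hM : 0 < c * (Real.pi / 2) + K / c := by positivity
  refine ⟨fun z => f (c * θ z), ⟨Real.toNNReal _, Real.toNNReal_pos.2 hM, fun z hz z' hz' => ?_⟩,
    Subset.antisymm ?_ ?_⟩
  · obtain ⟨h1, h2⟩ := hdist z hz _ (hθm z')
    rw [hθe z' hz', e.dist_map] at h1 h2
    rw [Real.coe_toNNReal _ hM.le, inv_mul_le_iff₀ hM]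
    have h3 : 0 ≤ c * (Real.pi / 2) * dist (f (c * θ z)) (f (c * θ z')) := by positivity
    have h4 : 0 ≤ K / c * dist z z' := by positivity
    constructor <;> linarith
  · rintro _ ⟨z, -, rfl⟩
    exact mem_image_of_mem f (hmem _ (hθm z))
  · rintro _ ⟨t, ht, rfl⟩
    have hs : t / c ∈ Icc 0 (2 * Real.pi) :=
      ⟨div_nonneg ht.1 hc0.le, by rw [div_le_iff₀ hc0, mul_comm, hcT]; exact ht.2⟩
    have hz : e.symm (Complex.exp ((t / c : ℝ) * Complex.I)) ∈ unitCircle :=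
      mem_sphere_zero_iff_norm.2 (by rw [e.symm.norm_map, Complex.norm_exp_ofReal_mul_I])
    refine ⟨_, hz, dist_le_zero.1 ?_⟩
    have h1 := (hdist _ hz _ hs).1
    rwa [e.apply_symm_apply, dist_self, mul_zero, mul_div_cancel₀ _ hc0.ne'] at h1

/-- A biLipschitz map of a compact set is a homeomorphism onto its image. -/
theorem BiLipschitzOn.exists_homeomorph {A X : Type*} [MetricSpace A] [MetricSpace X]
    {f : A → X} {S : Set A} (h : BiLipschitzOn f S) (hS : IsCompact S) :
    ∃ e : ↥S ≃ₜ ↥(f '' S), ∀ x : S, (e x : X) = f x := by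
  obtain ⟨K, hK, h⟩ := h
  have hK' : (0 : ℝ) < K := hK
  have hf : ContinuousOn f S :=
    (LipschitzOnWith.of_dist_le_mul fun x hx y hy => (h x hx y hy).2).continuousOn
  have hinj : InjOn f S := fun x hx y hy hxy => by
    have := (h x hx y hy).1
    rw [hxy, dist_self, inv_mul_le_iff₀ hK', mul_zero] at this
    exact dist_le_zero.1 this
  have := isCompact_iff_compactSpace.1 hS
  have hemb := (continuousOn_iff_continuous_domRestrict.1 hf).isClosedEmbedding
    (injOn_iff_injective.1 hinj)
  exact ⟨hemb.isEmbedding.toHomeomorph.trans (.setCongr (range_domRestrict f S)), fun x => rfl⟩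

/-- Around every point which is not too close to the boundary of the disc there is a Jordan domain
of controlled size bounded by a biLipschitz curve. -/
theorem exists_biLipschitz_isJordanDomain {X : Type*} [MetricSpace X] [CompactSpace X]
    (hX : IsLocallyGeodesicSpace X) {ψ : X → ℂ} (hψ : IsClosedEmbedding ψ)
    (hrange : range ψ = closedBall 0 1) {w : ℂ} {r : ℝ} (hr : 0 < r) (hw : ‖w‖ ≤ 1 - r) :
    ∃ T : Set X, IsBiLipschitzCurve T ∧ ∃ Ω, IsJordanDomain Ω ∧ T = frontier Ω ∧
      ψ ⁻¹' closedBall w (r / 4) ⊆ Ω ∧ Ω ⊆ ψ ⁻¹' ball w r := by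
  have hball : ball w r ⊆ range ψ := by
    rw [hrange]
    intro z hz
    rw [mem_ball, dist_eq_norm] at hz
    rw [mem_closedBall_zero_iff]
    linarith [norm_le_norm_add_norm_sub' z w]
  set G : X → ℝ := fun p => |‖ψ p - w‖ - r / 2| / (r / 8) with hGdef
  have hG : Continuous G := by
    have := hψ.continuous
    fun_prop
  have hG2 : ∀ p, G p ≤ 2 → r / 4 ≤ ‖ψ p - w‖ := fun p hp => by
    rw [hGdef, div_le_iff₀ (by positivity), abs_le] at hp
    linarith
  have hG2' : ∀ p, G p < 2 → r / 4 < ‖ψ p - w‖ ∧ ‖ψ p - w‖ < r := fun p hp => by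
    rw [hGdef, div_lt_iff₀ (by positivity), abs_lt] at hp
    constructor <;> linarith
  have hc : ∀ t : ℝ, w + (r / 2 : ℝ) * Complex.exp (t * Complex.I) ∈ range ψ := fun t => by
    refine hball ?_
    rw [mem_ball, dist_eq_norm, add_sub_cancel_left, norm_mul, Complex.norm_exp_ofReal_mul_I,
      Complex.norm_real, Real.norm_of_nonneg (by positivity)]
    linarith
  choose f₀ hf₀ using hc
  obtain ⟨f, T, K, Δ, hT, hK, hclosed, hΔ0, hΔ, hfG, hL, hmin⟩ :=
    exists_biLipschitz_loop hX hG (g := fun p => ψ p - w)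
    (hψ.continuous.sub continuous_const) (fun p hp h => by
      have := hG2 p hp
      rw [h, norm_zero] at this
      linarith) (f₀ := f₀) (a := 0) (b := 2 * Real.pi) Real.two_pi_pos.le
    (Continuous.continuousOn (hψ.isInducing.continuous_iff.2 (by
      rw [show ψ ∘ f₀ = _ from funext hf₀]; fun_prop)))
    (fun t _ => by
      simp [hGdef, hf₀, Complex.norm_exp_ofReal_mul_I, abs_of_pos hr])
    (hψ.injective (by rw [hf₀, hf₀]; simp))
    ((HasLogIncrement.circle (half_pos hr)).congr fun t _ => by simp [hf₀])
    Complex.two_pi_I_ne_zero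
  obtain ⟨F, hF, hFT⟩ := exists_biLipschitzOn_unitCircle hT hK hclosed hL hmin
  have hfc : ContinuousOn (fun t => ψ (f t)) (Icc 0 T) := hψ.continuous.comp_continuousOn
    (LipschitzOnWith.of_dist_le_mul (K := 1) fun s hs t ht => by
      simpa [Real.dist_eq] using hL s hs t ht).continuousOn
  set Ω := connectedComponentIn ((fun t => ψ (f t)) '' Icc 0 T)ᶜ w with hΩ
  have hR : ∀ t ∈ Icc 0 T, ψ (f t) ∈ ball w r := fun t ht => by
    rw [mem_ball, dist_eq_norm]
    exact (hG2' _ (hfG t ht)).2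
  have hfar : ∀ t ∈ Icc 0 T, r / 4 < ‖ψ (f t) - w‖ := fun t ht => (hG2' _ (hfG t ht)).1
  have hsub : Ω ⊆ ball w r :=
    connectedComponentIn_subset_ball hT.le hfc (congrArg ψ hclosed) hR hΔ hΔ0
  have hinj : InjOn (fun t => ψ (f t)) (Ico 0 T) := by
    intro s hs t ht hst
    have h1 := hmin s (Ico_subset_Icc_self hs) t (Ico_subset_Icc_self ht)
    rw [hψ.injective hst, dist_self, mul_zero] at h1
    rcases min_le_iff.1 h1 with h | h
    · exact sub_eq_zero.1 (abs_nonpos_iff.1 h)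
    · have : |s - t| < T := abs_lt.2 ⟨by linarith [hs.1, ht.2], by linarith [hs.2, ht.1]⟩
      linarith
  have hfront : frontier Ω = (fun t => ψ (f t)) '' Icc 0 T :=
    frontier_connectedComponentIn_eq hT hfc (congrArg ψ hclosed) hinj hR (fun t ht h => by
      have := hfar t ht
      rw [h, sub_self, norm_zero] at this
      linarith) hΔ hΔ0
  have hin : closedBall w (r / 4) ⊆ Ω :=
    (convex_closedBall _ _).isPreconnected.subset_connectedComponentIn
      (mem_closedBall_self (by positivity)) (by
        rintro z hz ⟨t, ht, rfl⟩
        rw [mem_closedBall, dist_eq_norm] at hz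
        linarith [hfar t ht])
  have hopen : IsOpen Ω :=
    (isCompact_Icc.image_of_continuousOn hfc).isClosed.isOpen_compl.connectedComponentIn
  have himg : ψ '' (ψ ⁻¹' Ω) = Ω := image_preimage_eq_of_subset (hsub.trans hball)
  have hfrontier : frontier (ψ ⁻¹' Ω) = f '' Icc 0 T := by
    have h1 : closure (ψ ⁻¹' Ω) = ψ ⁻¹' closure Ω := by
      rw [← hψ.injective.preimage_image (closure (ψ ⁻¹' Ω)), ← hψ.closure_image_eq, himg]
    rw [(hopen.preimage hψ.continuous).frontier_eq, h1, ← preimage_sdiff, ← hopen.frontier_eq,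
      hfront, ← image_image ψ f, hψ.injective.preimage_image]
  obtain ⟨e, -⟩ := hF.exists_homeomorph (isCompact_sphere _ _)
  refine ⟨f '' Icc 0 T, .inl ⟨F, hF, hFT⟩, ψ ⁻¹' Ω, ⟨hopen.preimage hψ.continuous, ?_, ?_⟩,
    hfrontier.symm, preimage_mono hin, preimage_mono hsub⟩
  · refine ⟨?_, hψ.isInducing.isPreconnected_image.1 (by
      rw [himg]
      exact isPreconnected_connectedComponentIn)⟩
    exact (nonempty_of_mem (hin (mem_closedBall_self (by positivity)))).preimage'
      (hsub.trans hball)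
  · rw [hfrontier]
    exact ⟨((Homeomorph.setCongr hFT.symm).trans e.symm)⟩

section

open scoped ComplexConjugate

theorem log_mul_of_im_pos {c z : ℂ} (hc : 0 < c.im) (hz : 0 < z.re) (hcz : 0 < (c * z).re) :
    Complex.log (c * z) = Complex.log c + Complex.log z := by
  have hc0 : c ≠ 0 := fun h => by simp [h] at hc
  have hz0 : z ≠ 0 := fun h => by simp [h] at hz
  have h1 : 0 ≤ c.arg := Complex.arg_nonneg_iff.2 hc.le
  have h2 := abs_lt.1 (Complex.abs_arg_lt_pi_div_two_iff.2 (.inl hz))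
  have hπ := Real.pi_pos
  refine Complex.log_mul hc0 hz0 ⟨by linarith, ?_⟩
  by_contra! h
  have h3 : (c * z).re = ‖c‖ * ‖z‖ * Real.cos (c.arg + z.arg) := by
    conv_lhs => rw [← Complex.norm_mul_exp_arg_mul_I c, ← Complex.norm_mul_exp_arg_mul_I z,
      mul_mul_mul_comm, ← Complex.exp_add, ← add_mul, ← Complex.ofReal_add, ← Complex.ofReal_mul,
      Complex.re_ofReal_mul, Complex.exp_ofReal_mul_I_re]
  have h4 := Real.cos_nonpos_of_pi_div_two_le_of_le (x := c.arg + z.arg) (by linarith)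
    (by linarith [c.arg_le_pi])
  have := mul_nonpos_of_nonneg_of_nonpos (mul_nonneg (norm_nonneg c) (norm_nonneg z)) h4
  linarith

theorem one_sub_conj_mul_re_pos {a z : ℂ} (ha : ‖a‖ = 1) (hz : ‖z‖ ≤ 1) (haz : z ≠ a) :
    0 < (1 - conj a * z).re := by
  have h1 := Complex.normSq_pos.2 (sub_ne_zero.2 haz)
  have h2 : Complex.normSq a = 1 := by rw [Complex.normSq_eq_norm_sq, ha, one_pow]
  have h3 : Complex.normSq z ≤ 1 := by
    rw [Complex.normSq_eq_norm_sq]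
    exact pow_le_one₀ (norm_nonneg z) hz
  simp only [Complex.normSq_apply, Complex.sub_re, Complex.sub_im, Complex.mul_re, Complex.one_re,
    Complex.conj_re, Complex.conj_im] at *
  nlinarith

/-- In the closed unit disc, a path joining the upper to the lower half of the unit circle inside a
vertical strip meets every path which joins the two sides of the strip. -/
theorem exists_eq_of_crossing {γ σ : ℝ → ℂ} {α β : ℝ} (hγ : ContinuousOn γ (Icc 0 1))
    (hσ : ContinuousOn σ (Icc 0 1)) (hγre : ∀ t ∈ Icc (0 : ℝ) 1, α < (γ t).re ∧ (γ t).re < β)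
    (hσ1 : ∀ s ∈ Icc (0 : ℝ) 1, ‖σ s‖ ≤ 1) (hγ0 : ‖γ 0‖ = 1) (hγ1 : ‖γ 1‖ = 1)
    (him0 : 0 < (γ 0).im) (him1 : (γ 1).im < 0) (hσα : (σ 0).re ≤ α) (hσβ : β ≤ (σ 1).re) :
    ∃ t ∈ Icc (0 : ℝ) 1, ∃ s ∈ Icc (0 : ℝ) 1, γ t = σ s := by
  by_contra! hne
  have h01 : (0 : ℝ) ∈ Icc (0 : ℝ) 1 := ⟨le_rfl, zero_le_one⟩
  have h11 : (1 : ℝ) ∈ Icc (0 : ℝ) 1 := ⟨zero_le_one, le_rfl⟩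
  have hunit : ∀ a z : ℂ, ‖a‖ = 1 → a * (1 - conj a * z) = a - z := fun a z ha => by
    rw [mul_sub, ← mul_assoc, Complex.mul_conj, Complex.normSq_eq_norm_sq, ha]
    simp
  have hside : ∀ t ∈ Icc (0 : ℝ) 1, ‖γ t‖ = 1 →
      HasLogIncrement (fun s => γ t - σ s) 0 1
        (Complex.log (1 - conj (γ t) * σ 1) - Complex.log (1 - conj (γ t) * σ 0)) := by
    intro t ht hnorm
    have h0 : γ t ≠ 0 := norm_pos_iff.1 (by rw [hnorm]; exact one_pos)
    have := (HasLogIncrement.const (a := 0) (b := 1) h0).mul_slitPlane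
      (u := fun s => 1 - conj (γ t) * σ s) (by fun_prop) fun s hs =>
        .inl (one_sub_conj_mul_re_pos hnorm (hσ1 s hs) (hne t ht s hs).symm)
    rw [zero_add] at this
    exact this.congr fun s _ => (hunit _ _ hnorm).symm
  have hre0 : ∀ t ∈ Icc (0 : ℝ) 1, 0 < (γ t - σ 0).re := fun t ht => by
    rw [Complex.sub_re]; linarith [(hγre t ht).1]
  have hre1 : ∀ t ∈ Icc (0 : ℝ) 1, 0 < (σ 1 - γ t).re := fun t ht => by
    rw [Complex.sub_re]; linarith [(hγre t ht).2]
  have hbot : HasLogIncrement (fun t => γ t - σ 0) 0 1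
      (Complex.log (γ 1 - σ 0) - Complex.log (γ 0 - σ 0)) :=
    .of_slitPlane (by fun_prop) fun t ht => .inl (hre0 t ht)
  have htop : HasLogIncrement (fun t => γ t - σ 1) 0 1
      (Complex.log (σ 1 - γ 1) - Complex.log (σ 1 - γ 0)) := by
    have := (HasLogIncrement.const (a := 0) (b := 1) (neg_ne_zero.2 one_ne_zero)).mul_slitPlane
      (u := fun t => σ 1 - γ t) (by fun_prop) fun t ht => .inl (hre1 t ht)
    rw [zero_add] at this
    exact this.congr fun t _ => by ring
  have hsum := HasLogIncrement.add_eq_add_of_rectangle (f := fun t s => γ t - σ s) zero_le_one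
    zero_le_one ((hγ.comp continuousOn_fst fun p hp => hp.1).sub
      (hσ.comp continuousOn_snd fun p hp => hp.2))
    (fun t ht s hs => sub_ne_zero.2 (hne t ht s hs)) hbot (hside 1 h11 hγ1) htop (hside 0 h01 hγ0)
  have hpos : ∀ t ∈ Icc (0 : ℝ) 1, ‖γ t‖ = 1 → ∀ s ∈ Icc (0 : ℝ) 1,
      0 < (1 - conj (γ t) * σ s).re := fun t ht hnorm s hs =>
    one_sub_conj_mul_re_pos hnorm (hσ1 s hs) (hne t ht s hs).symm
  have hunit' : ∀ a z : ℂ, ‖a‖ = 1 → conj a * (a - z) = 1 - conj a * z := fun a z ha => by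
    rw [mul_sub, ← Complex.normSq_eq_conj_mul_self, Complex.normSq_eq_norm_sq, ha]
    simp
  have e1 := log_mul_of_im_pos him0 (hpos 0 h01 hγ0 0 h01)
    (by rw [hunit _ _ hγ0]; exact hre0 0 h01)
  have e2 := log_mul_of_im_pos (c := -conj (γ 0)) (z := σ 1 - γ 0) (by simpa using him0)
    (hre1 0 h01) (by
      rw [neg_mul, ← mul_neg, neg_sub, hunit' _ _ hγ0]; exact hpos 0 h01 hγ0 1 h11)
  have e3 := log_mul_of_im_pos (c := conj (γ 1)) (z := γ 1 - σ 0) (by simpa using him1)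
    (hre0 1 h11) (by rw [hunit' _ _ hγ1]; exact hpos 1 h11 hγ1 0 h01)
  have e4 := log_mul_of_im_pos (c := -γ 1) (z := 1 - conj (γ 1) * σ 1) (by simpa using him1)
    (hpos 1 h11 hγ1 1 h11) (by
      rw [neg_mul, hunit _ _ hγ1, neg_sub]; exact hre1 1 h11)
  rw [hunit _ _ hγ0] at e1
  rw [neg_mul, ← mul_neg, neg_sub, hunit' _ _ hγ0] at e2
  rw [hunit' _ _ hγ1] at e3
  rw [neg_mul, hunit _ _ hγ1, neg_sub] at e4
  have key : Complex.log (γ 0) + Complex.log (-conj (γ 0)) + Complex.log (conj (γ 1)) +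
      Complex.log (-γ 1) = 0 := by linear_combination -hsum - e1 - e2 - e3 - e4
  have harg : ∀ {z : ℂ}, 0 < z.im → 0 < (Complex.log z).im := fun {z} hz => by
    rw [Complex.log_im]
    refine (Complex.arg_nonneg_iff.2 hz.le).lt_of_ne fun h => hz.ne' ?_
    exact (Complex.arg_eq_zero_iff.1 h.symm).2
  have key' := congrArg Complex.im key
  simp only [Complex.add_im, Complex.zero_im] at key'
  linarith [harg him0, harg (z := -conj (γ 0)) (by simpa using him0),
    harg (z := conj (γ 1)) (by simpa using him1), harg (z := -γ 1) (by simpa using him1)]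

/-- Near a boundary point of the disc there is a biLipschitz arc with endpoints on the boundary which
cuts off a component of controlled size. -/
theorem exists_biLipschitz_isJordanArc {X : Type*} [MetricSpace X] [CompactSpace X]
    [LocallyPathConnectedSpace X] (hX : IsLocallyGeodesicSpace X) {ψ : X → ℂ}
    (hψ : IsClosedEmbedding ψ) (hrange : range ψ = closedBall 0 1) {r : ℝ} (hr : 0 < r)
    (hr4 : r ≤ 1 / 4) :
    ∃ T : Set X, IsBiLipschitzCurve T ∧
      IsJordanArcMeetingBoundaryAtEndpoints T {p | ‖ψ p‖ = 1} ∧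
      ∃ Ω : Set X, (∃ p ∈ Tᶜ, Ω = connectedComponentIn Tᶜ p) ∧
        {p | 1 - 2 * r ≤ (ψ p).re} ⊆ Ω ∧ Ω ⊆ {p | 1 - 4 * r ≤ (ψ p).re} := by
  have hψc := hψ.continuous
  have hnorm : ∀ p, ‖ψ p‖ ≤ 1 := fun p => by
    rw [← mem_closedBall_zero_iff, ← hrange]
    exact mem_range_self p
  set G : X → ℝ := fun p => |(ψ p).re - (1 - 3 * r)| / (r / 2) with hGdef
  have hG : Continuous G := by
    have := Complex.continuous_re.comp hψc
    simp only [Function.comp_def] at this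
    fun_prop
  have hG2 : ∀ p, G p < 2 → 1 - 4 * r < (ψ p).re ∧ (ψ p).re < 1 - 2 * r := fun p hp => by
    rw [hGdef, div_lt_iff₀ (by positivity), abs_lt] at hp
    constructor <;> linarith
  have hre : ∀ p, ‖ψ p‖ = 1 → (ψ p).im = 0 → 2 < G p := fun p h1 h2 => by
    have h3 : (ψ p).re * (ψ p).re = 1 := by
      have := Complex.normSq_eq_norm_sq (ψ p)
      rw [h1, Complex.normSq_apply, h2] at this
      linarith
    rw [hGdef, lt_div_iff₀ (by positivity), lt_abs]
    rcases mul_self_eq_one_iff.1 h3 with h | h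
    · left; rw [h]; linarith
    · right; rw [h]; linarith
  have hA : IsClosed {p | ‖ψ p‖ = 1 ∧ 0 ≤ (ψ p).im} :=
    (isClosed_eq hψc.norm continuous_const).inter
      (isClosed_le continuous_const (Complex.continuous_im.comp hψc))
  have hB : IsClosed {p | ‖ψ p‖ = 1 ∧ (ψ p).im ≤ 0} :=
    (isClosed_eq hψc.norm continuous_const).inter
      (isClosed_le (Complex.continuous_im.comp hψc) continuous_const)
  have hh : 0 ≤ 1 - (1 - 3 * r) ^ 2 := by nlinarith
  set c : ℝ → ℂ := fun t =>
    ((1 - 3 * r : ℝ) : ℂ) - (√(1 - (1 - 3 * r) ^ 2) * Real.sin t : ℝ) * Complex.I with hcdef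
  have hcre : ∀ t, (c t).re = 1 - 3 * r := fun t => by simp [hcdef]
  have hcim : ∀ t, (c t).im = -(√(1 - (1 - 3 * r) ^ 2) * Real.sin t) := fun t => by
    simp only [hcdef, Complex.sub_im, Complex.ofReal_im, Complex.im_ofReal_mul, Complex.I_im,
      mul_one, zero_sub]
  have hcsq : ∀ t, ‖c t‖ ^ 2 = (1 - 3 * r) ^ 2 + (1 - (1 - 3 * r) ^ 2) * Real.sin t ^ 2 :=
    fun t => by
    rw [← Complex.normSq_eq_norm_sq, Complex.normSq_apply, hcre, hcim, neg_mul_neg,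
      mul_mul_mul_comm, Real.mul_self_sqrt hh]
    ring
  have hc : ∀ t, c t ∈ range ψ := fun t => by
    rw [hrange, mem_closedBall_zero_iff]
    refine le_of_sq_le_sq ?_ zero_le_one
    rw [hcsq]
    nlinarith [Real.sin_sq_le_one t]
  choose f₀ hf₀ using hc
  have hend : ∀ t, Real.sin t ^ 2 = 1 → ‖ψ (f₀ t)‖ = 1 := fun t ht => by
    have := hcsq t
    rw [ht] at this
    rw [hf₀, ← sq_eq_sq₀ (norm_nonneg _) zero_le_one, this]
    ring
  obtain ⟨f, hf, hfA, hfB, hint, hfG⟩ := exists_biLipschitz_arc hX hG hA hB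
    (fun p h1 h2 => hre p h1.1 (h2.2.antisymm h1.2)) (f₀ := f₀) (a := -(Real.pi / 2))
    (b := Real.pi / 2) (by linarith [Real.pi_pos])
    (Continuous.continuousOn (hψ.isInducing.continuous_iff.2 (by
      rw [show ψ ∘ f₀ = c from funext hf₀]; fun_prop)))
    (fun t _ => by simp [hGdef, hf₀, hcre])
    ⟨hend _ (by simp), by rw [hf₀, hcim]; simp⟩
    ⟨hend _ (by simp), by rw [hf₀, hcim]; simp⟩
  have h01 : (0 : ℝ) ∈ Icc (0 : ℝ) 1 := ⟨le_rfl, zero_le_one⟩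
  have h11 : (1 : ℝ) ∈ Icc (0 : ℝ) 1 := ⟨zero_le_one, le_rfl⟩
  set T := f '' Icc 0 1 with hT
  obtain ⟨e, he⟩ := hf.exists_homeomorph isCompact_Icc
  have hfc : ContinuousOn f (Icc 0 1) := by
    rw [continuousOn_iff_continuous_domRestrict]
    exact (continuous_subtype_val.comp e.continuous).congr he
  have hTc : IsOpen Tᶜ := (isCompact_Icc.image_of_continuousOn hfc).isClosed.isOpen_compl
  obtain ⟨p, hp⟩ : (1 : ℂ) ∈ range ψ := by rw [hrange]; simp
  have hcap : {p | 1 - 2 * r ≤ (ψ p).re} ⊆ Tᶜ := by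
    rintro _ hq ⟨t, ht, rfl⟩
    exact (hG2 _ (hfG t ht)).2.not_ge hq
  have hpcap : p ∈ {p | 1 - 2 * r ≤ (ψ p).re} := by
    show 1 - 2 * r ≤ (ψ p).re
    rw [hp, Complex.one_re]
    linarith
  refine ⟨T, .inr ⟨f, hf, rfl⟩, ⟨e, ?_⟩, connectedComponentIn Tᶜ p, ⟨p, hcap hpcap, rfl⟩, ?_, ?_⟩
  · rw [he, he]
    refine Subset.antisymm ?_ (pair_subset ⟨mem_image_of_mem f h01, hfA.1⟩
      ⟨mem_image_of_mem f h11, hfB.1⟩)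
    rintro _ ⟨⟨t, ht, rfl⟩, hb⟩
    rcases ht.1.eq_or_lt with rfl | h0
    · exact .inl rfl
    rcases ht.2.eq_or_lt with rfl | h1
    · exact .inr rfl
    exact absurd ((le_total 0 (ψ (f t)).im).imp (fun h => ⟨hb, h⟩) fun h => ⟨hb, h⟩)
      (hint t ⟨h0, h1⟩)
  · refine IsPreconnected.subset_connectedComponentIn ?_ hpcap hcap
    rw [← hψ.isInducing.isPreconnected_image]
    have : ψ '' {p | 1 - 2 * r ≤ (ψ p).re} = closedBall 0 1 ∩ {z | 1 - 2 * r ≤ z.re} := by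
      rw [← hrange, inter_comm, ← image_preimage_eq_inter_range]
      rfl
    rw [this]
    exact ((convex_closedBall _ _).inter (convex_halfSpace_re_ge _)).isPreconnected
  · intro q hq
    by_contra hqr
    have hqr' : (ψ q).re ≤ 1 - 4 * r := (not_le.1 hqr).le
    have hpc : IsPathConnected (connectedComponentIn Tᶜ p) :=
      hTc.connectedComponentIn.isConnected_iff_isPathConnected.1
        (isConnected_connectedComponentIn_iff.2 (hcap hpcap))
    obtain ⟨σ, hσ⟩ := hpc.joinedIn q hq p (mem_connectedComponentIn (hcap hpcap))
    obtain ⟨t, ht, s, -, hts⟩ := exists_eq_of_crossing (γ := fun t => ψ (f t))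
      (σ := fun s => ψ (σ.extend s)) (hψc.comp_continuousOn hfc)
      (hψc.comp σ.continuous_extend).continuousOn (fun t ht => hG2 _ (hfG t ht))
      (fun s _ => hnorm _) hfA.1 hfB.1
      (hfA.2.lt_of_ne fun h => (hre _ hfA.1 h.symm).not_gt (hfG 0 h01))
      (hfB.2.lt_of_ne fun h => (hre _ hfB.1 h).not_gt (hfG 1 h11))
      (by simpa using hqr') (by simpa using hpcap)
    exact connectedComponentIn_subset _ _ (hσ (projIcc 0 1 zero_le_one s))
      ⟨t, ht, hψ.injective hts⟩

end

/-- The circular segment cut off from the unit disc by a vertical line is close to `1`. -/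
theorem norm_sub_one_sq_le {z : ℂ} {r : ℝ} (hz : ‖z‖ ≤ 1) (hr : 1 - 4 * r ≤ z.re) :
    ‖z - 1‖ ^ 2 ≤ 8 * r := by
  have h : z.re * z.re + z.im * z.im ≤ 1 := by
    rw [← Complex.normSq_apply, Complex.normSq_eq_norm_sq]
    exact pow_le_one₀ (norm_nonneg z) hz
  rw [← Complex.normSq_eq_norm_sq, Complex.normSq_apply]
  simp only [Complex.sub_re, Complex.sub_im, Complex.one_re, Complex.one_im]
  linarith

/-- Lemma 4.2: existence of small biLipschitz Jordan curves or arcs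
enclosing a given ball. -/
theorem biLipschitz_jordan_neighborhoods
    {X : Type*} [MetricSpace X]
    (hgeo : IsLocallyGeodesicSpace X)
    (φ : ↥unitClosedDisc ≃ₜ X)
    (ε : ℝ) (hε : 0 < ε) :
    ∃ ε' : ℝ, 0 < ε' ∧ ∀ x : X, ∃ T : Set X, IsBiLipschitzCurve T ∧
      ((∃ Ω : Set X, IsJordanDomain Ω ∧ T = frontier Ω ∧ Metric.closedBall x ε' ⊆ Ω ∧
          EMetric.diam Ω ≤ ENNReal.ofReal ε) ∨
        (IsJordanArcMeetingBoundaryAtEndpoints T (discBoundary φ) ∧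
          ∃ Ω : Set X, (∃ p ∈ Tᶜ, Ω = connectedComponentIn Tᶜ p) ∧
            Metric.closedBall x ε' ⊆ Ω ∧ EMetric.diam Ω ≤ ENNReal.ofReal ε)) := by
  have : CompactSpace unitClosedDisc := isCompact_iff_compactSpace.1 (isCompact_closedBall _ _)
  have : CompactSpace X := φ.compactSpace
  have : LocallyPathConnectedSpace unitClosedDisc :=
    (convex_closedBall (0 : E2) 1).locallyPathConnectedSpace
  have : LocallyPathConnectedSpace X := φ.symm.isOpenEmbedding.locallyPathConnectedSpace
  set e : E2 ≃ₗᵢ[ℝ] ℂ := Complex.orthonormalBasisOneI.repr.symm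
  set ψ : X → ℂ := fun x => e (φ.symm x) with hψdef
  have hψ : IsClosedEmbedding ψ := e.toHomeomorph.isClosedEmbedding.comp
    ((isClosed_closedBall.isClosedEmbedding_subtypeVal).comp φ.symm.isClosedEmbedding)
  have hnorm : ∀ p, ‖ψ p‖ = ‖((φ.symm p : ↥unitClosedDisc) : E2)‖ := fun p => e.norm_map _
  have hle : ∀ p, ‖ψ p‖ ≤ 1 := fun p => by
    rw [hnorm]
    exact mem_closedBall_zero_iff.1 (φ.symm p).2
  have hrange : range ψ = closedBall 0 1 := by
    refine Subset.antisymm (range_subset_iff.2 fun p => mem_closedBall_zero_iff.2 (hle p))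
      fun z hz => ?_
    have hz' : e.symm z ∈ unitClosedDisc :=
      mem_closedBall_zero_iff.2 (by rw [e.symm.norm_map]; exact mem_closedBall_zero_iff.1 hz)
    exact ⟨φ ⟨_, hz'⟩, by simp [hψdef]⟩
  have hbdry : discBoundary φ = {p | ‖ψ p‖ = 1} := by
    ext p
    change _ ∈ sphere _ _ ↔ ‖ψ p‖ = 1
    rw [mem_sphere_zero_iff_norm, hnorm]
  obtain ⟨δ, hδ, hφδ⟩ := Metric.uniformContinuous_iff.1
    (CompactSpace.uniformContinuous_of_continuous φ.continuous) ε hε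
  have hdiam : ∀ Ω : Set X, (∀ p ∈ Ω, ∀ q ∈ Ω, dist (ψ p) (ψ q) < δ) →
      Metric.ediam Ω ≤ ENNReal.ofReal ε := fun Ω hΩ =>
    Metric.ediam_le fun p hp q hq => by
      rw [edist_dist]
      refine ENNReal.ofReal_le_ofReal ?_
      have := hφδ (a := φ.symm p) (b := φ.symm q) (by
        rw [Subtype.dist_eq, ← e.dist_map]
        exact hΩ p hp q hq)
      simpa using this.le
  obtain ⟨r, hr, hr4, hrδ, hrδ'⟩ : ∃ r : ℝ, 0 < r ∧ r ≤ 1 / 4 ∧ 2 * r ≤ δ ∧ 8 * r < (δ / 2) ^ 2 :=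
    ⟨min (1 / 4) (min (δ / 2) ((δ / 2) ^ 2 / 9)), by positivity, min_le_left _ _, by
      have : min (1 / 4) (min (δ / 2) ((δ / 2) ^ 2 / 9)) ≤ δ / 2 :=
        (min_le_right _ _).trans (min_le_left _ _)
      linarith, by
      have : min (1 / 4) (min (δ / 2) ((δ / 2) ^ 2 / 9)) ≤ (δ / 2) ^ 2 / 9 :=
        (min_le_right _ _).trans (min_le_right _ _)
      have : 0 < (δ / 2) ^ 2 := by positivity
      linarith⟩
  obtain ⟨δ', hδ', hψδ⟩ := Metric.uniformContinuous_iff.1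
    (CompactSpace.uniformContinuous_of_continuous hψ.continuous) (r / 4) (by positivity)
  refine ⟨δ' / 2, half_pos hδ', fun x => ?_⟩
  have hball : ∀ p ∈ closedBall x (δ' / 2), dist (ψ p) (ψ x) < r / 4 := fun p hp =>
    hψδ ((mem_closedBall.1 hp).trans_lt (half_lt_self hδ'))
  rcases le_or_gt ‖ψ x‖ (1 - r) with hx | hx
  · obtain ⟨T, hT, Ω, hΩ, hTΩ, hin, hout⟩ :=
      exists_biLipschitz_isJordanDomain hgeo hψ hrange hr hx
    refine ⟨T, hT, .inl ⟨Ω, hΩ, hTΩ, fun p hp => hin (hball p hp).le, hdiam Ω fun p hp q hq => ?_⟩⟩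
    have h1 : dist (ψ p) (ψ x) < r := hout hp
    have h2 : dist (ψ q) (ψ x) < r := hout hq
    linarith [dist_triangle_right (ψ p) (ψ q) (ψ x)]
  · have hx0 : (‖ψ x‖ : ℂ) ≠ 0 := by
      rw [Complex.ofReal_ne_zero]
      linarith
    set v : ℂ := starRingEnd ℂ (ψ x / ‖ψ x‖) with hv
    have hv1 : ‖v‖ = 1 := by
      rw [hv, RCLike.norm_conj, norm_div, Complex.norm_real, norm_norm, div_self]
      exact_mod_cast hx0
    have hv0 : v ≠ 0 := norm_pos_iff.1 (by rw [hv1]; exact one_pos)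
    have hvx : v * ψ x = ‖ψ x‖ := by
      rw [hv, map_div₀, Complex.conj_ofReal, div_mul_eq_mul_div, Complex.conj_mul', sq,
        mul_div_cancel_right₀ _ hx0]
    have hvn : ∀ z, ‖v * z‖ = ‖z‖ := fun z => by rw [norm_mul, hv1, one_mul]
    have hrange' : range (fun p => v * ψ p) = closedBall 0 1 := by
      refine Subset.antisymm (range_subset_iff.2 fun p => mem_closedBall_zero_iff.2
        ((hvn _).trans_le (hle p))) fun z hz => ?_
      obtain ⟨p, hp⟩ : v⁻¹ * z ∈ range ψ := by
        rw [hrange, mem_closedBall_zero_iff, norm_mul, norm_inv, hv1, inv_one, one_mul]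
        exact mem_closedBall_zero_iff.1 hz
      exact ⟨p, by simp only [hp, mul_inv_cancel_left₀ hv0]⟩
    obtain ⟨T, hT, harc, Ω, hΩ, hin, hout⟩ := exists_biLipschitz_isJordanArc hgeo
      ((Homeomorph.mulLeft₀ v hv0).isClosedEmbedding.comp hψ) hrange' hr hr4
    refine ⟨T, hT, .inr ⟨?_, Ω, hΩ, fun p hp => hin ?_, hdiam Ω fun p hp q hq => ?_⟩⟩
    · rw [hbdry]
      simpa [hv1] using harc
    · change 1 - 2 * r ≤ (v * ψ p).re
      have h1 : v * ψ p = ‖ψ x‖ + v * (ψ p - ψ x) := by rw [mul_sub, hvx]; ring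
      have h2 := hball p hp
      rw [dist_eq_norm, ← hvn] at h2
      have h3 := (abs_le.1 (Complex.abs_re_le_norm (v * (ψ p - ψ x)))).1
      rw [h1, Complex.add_re, Complex.ofReal_re]
      linarith
    · have hnear : ∀ p ∈ Ω, ‖v * ψ p - 1‖ < δ / 2 := fun p hp =>
        lt_of_pow_lt_pow_left₀ 2 (by positivity)
          ((norm_sub_one_sq_le ((hvn _).trans_le (hle p)) (hout hp)).trans_lt hrδ')
      rw [dist_eq_norm, ← hvn, mul_sub, ← sub_sub_sub_cancel_right _ _ 1]
      linarith [norm_sub_le (v * ψ p - 1) (v * ψ q - 1), hnear p hp, hnear q hq]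

end
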